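/- arXiv:1209.5096 — 6 statements merged into one kernel-verified Lean document; each statement's English description precedes it below -/
import Mathlib

section
/- Let U be a nondiscrete unital subring of ℝ. Suppose A and B are positive square matrices with entries in U which are strong shift equivalent over U. Then there exist a size n, positive n×n matrices A' and B' over U, and a matrix W ∈ GL(n,ℝ) with entries of W and W⁻¹ in U, such that: A is strong shift equivalent over U₊ to A', B is strong shift equivalent over U₊ to B', W⁻¹A'W = B', det W > 0, and for any positive row vector ℓ with ℓA' = ρℓ (ρ the spectral radius of A'), the row vector ℓW is positive. -/
open Matrix

/-- All entries of a real matrix lie in the set `S`. -/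
def entriesIn {m n : ℕ} (S : Set ℝ) (A : Matrix (Fin m) (Fin n) ℝ) : Prop :=
  ∀ i j, A i j ∈ S

/-- A matrix is positive if every entry is positive. -/
def PosEntries {m n : ℕ} (A : Matrix (Fin m) (Fin n) ℝ) : Prop :=
  ∀ i j, 0 < A i j

/-- Elementary strong shift equivalence over `S` between square real matrices
(of possibly different sizes). -/
def ESSE (S : Set ℝ) (p q : (n : ℕ) × Matrix (Fin n) (Fin n) ℝ) : Prop :=
  ∃ (R : Matrix (Fin p.1) (Fin q.1) ℝ) (S' : Matrix (Fin q.1) (Fin p.1) ℝ),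
    entriesIn S R ∧ entriesIn S S' ∧ p.2 = R * S' ∧ q.2 = S' * R

/-- Strong shift equivalence over `S`: a finite chain of elementary strong
shift equivalences. -/
def SSE (S : Set ℝ) : ((n : ℕ) × Matrix (Fin n) (Fin n) ℝ) →
    ((n : ℕ) × Matrix (Fin n) (Fin n) ℝ) → Prop :=
  Relation.ReflTransGen (ESSE S)

/-- Conjugacy of square matrices over a ring, with possibly different index types. -/
def Matrix.Conj {R m n : Type*} [CommRing R] [Fintype m] [Fintype n] [DecidableEq m]
    [DecidableEq n] (A : Matrix m m R) (B : Matrix n n R) : Prop :=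
  ∃ (P : Matrix m n R) (Q : Matrix n m R), P * Q = 1 ∧ Q * P = 1 ∧ A * P = P * B

namespace Matrix.Conj

variable {R m n p : Type*} [CommRing R] [Fintype m] [Fintype n] [Fintype p] [DecidableEq m]
  [DecidableEq n] [DecidableEq p]

theorem refl (A : Matrix m m R) : Conj A A :=
  ⟨1, 1, by simp, by simp, by simp⟩

theorem symm {A : Matrix m m R} {B : Matrix n n R} (h : Conj A B) : Conj B A := by
  obtain ⟨P, Q, hPQ, hQP, h⟩ := h
  refine ⟨Q, P, hQP, hPQ, ?_⟩
  calc B * Q = Q * P * B * Q := by rw [hQP, Matrix.one_mul]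
    _ = Q * (A * P) * Q := by rw [h, Matrix.mul_assoc Q P B]
    _ = Q * A := by rw [Matrix.mul_assoc, Matrix.mul_assoc, hPQ, Matrix.mul_one]

theorem trans {A : Matrix m m R} {B : Matrix n n R} {C : Matrix p p R}
    (h₁ : Conj A B) (h₂ : Conj B C) : Conj A C := by
  obtain ⟨P, Q, hPQ, hQP, h⟩ := h₁
  obtain ⟨P', Q', hPQ', hQP', h'⟩ := h₂
  refine ⟨P * P', Q' * Q, ?_, ?_, ?_⟩
  · rw [Matrix.mul_assoc, ← Matrix.mul_assoc P', hPQ', Matrix.one_mul, hPQ]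
  · rw [Matrix.mul_assoc, ← Matrix.mul_assoc Q, hQP, Matrix.one_mul, hQP']
  · rw [← Matrix.mul_assoc, h, Matrix.mul_assoc, h', Matrix.mul_assoc]

theorem transpose {A : Matrix m m R} {B : Matrix n n R} (h : Conj A B) : Conj Aᵀ Bᵀ := by
  obtain ⟨P, Q, hPQ, hQP, h⟩ := h.symm
  refine ⟨Pᵀ, Qᵀ, ?_, ?_, ?_⟩
  · rw [← transpose_mul, hQP, transpose_one]
  · rw [← transpose_mul, hPQ, transpose_one]
  · rw [← transpose_mul, ← transpose_mul, h]

theorem submatrix (e : n ≃ m) (A : Matrix m m R) : Conj A (A.submatrix e e) :=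
  ⟨(1 : Matrix m m R).submatrix id e, (1 : Matrix m m R).submatrix e id,
    by rw [submatrix_mul_equiv, Matrix.one_mul, submatrix_id_id],
    by rw [← submatrix_mul _ _ _ _ _ Function.bijective_id, Matrix.one_mul,
      submatrix_one_equiv],
    by
      conv_lhs => rw [← submatrix_id_id A]
      rw [← submatrix_mul _ _ _ _ _ Function.bijective_id, submatrix_mul_equiv, Matrix.mul_one,
        Matrix.one_mul]⟩

theorem fromBlocks_row {A : Matrix m m R} {B : Matrix n n R} (h : Conj A B) (X : Matrix p n R) :
    ∃ Y : Matrix p m R, Conj (fromBlocks A 0 Y 0) (fromBlocks B 0 X 0) := by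
  obtain ⟨P, Q, hPQ, hQP, h⟩ := h
  refine ⟨X * Q, fromBlocks P 0 0 1, fromBlocks Q 0 0 1, ?_, ?_, ?_⟩ <;>
    simp [fromBlocks_multiply, hPQ, hQP, h, Matrix.mul_assoc]

theorem fromBlocks_col {A : Matrix m m R} {B : Matrix n n R} (h : Conj A B) (X : Matrix n p R) :
    ∃ Y : Matrix m p R, Conj (fromBlocks A Y 0 0) (fromBlocks B X 0 0) := by
  obtain ⟨P, Q, hPQ, hQP, h⟩ := h
  refine ⟨P * X, fromBlocks P 0 0 1, fromBlocks Q 0 0 1, ?_, ?_, ?_⟩ <;>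
    simp [fromBlocks_multiply, hPQ, hQP, h]

theorem card_eq [Nontrivial R] {A : Matrix m m R} {B : Matrix n n R} (h : Conj A B) :
    Fintype.card m = Fintype.card n := by
  obtain ⟨P, Q, hPQ, hQP, -⟩ := h
  exact Matrix.square_of_invertible P Q hPQ hQP

/-- The conjugacy behind an elementary strong shift equivalence. -/
theorem fromBlocks_mul_swap (S : Matrix m n R) (T : Matrix n m R) :
    Conj (fromBlocks (S * T) 0 T 0) (fromBlocks (T * S) T 0 0) := by
  refine ⟨fromBlocks S 1 1 0, fromBlocks 0 1 1 (-S), ?_, ?_, ?_⟩ <;>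
    simp [fromBlocks_multiply, Matrix.mul_assoc]

end Matrix.Conj

section Extension

variable {R : Type*} [CommRing R]

/-- `ZeroExt p q` says that `q` is conjugate to the extension of `p` by zero columns or by zero
rows. -/
inductive ZeroExt (p q : (n : ℕ) × Matrix (Fin n) (Fin n) R) : Prop
  | row (r : ℕ) (X : Matrix (Fin r) (Fin p.1) R) (h : Conj (fromBlocks p.2 0 X 0) q.2)
  | col (r : ℕ) (X : Matrix (Fin p.1) (Fin r) R) (h : Conj (fromBlocks p.2 X 0 0) q.2)

namespace ZeroExt

variable {p q : (n : ℕ) × Matrix (Fin n) (Fin n) R} {m : Type*} [Fintype m] [DecidableEq m]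

theorem of_row {A : Matrix m m R} (hA : Conj p.2 A) {r : ℕ} (X : Matrix (Fin r) m R)
    (h : Conj (fromBlocks A 0 X 0) q.2) : ZeroExt p q :=
  have ⟨Y, hY⟩ := hA.fromBlocks_row X
  .row r Y (hY.trans h)

theorem of_col {A : Matrix m m R} (hA : Conj p.2 A) {r : ℕ} (X : Matrix m (Fin r) R)
    (h : Conj (fromBlocks A X 0 0) q.2) : ZeroExt p q :=
  have ⟨Y, hY⟩ := hA.fromBlocks_col X
  .col r Y (hY.trans h)

end ZeroExt

theorem Matrix.Conj.exists_fin {m : Type*} [Fintype m] [DecidableEq m] (A : Matrix m m R) :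
    ∃ q : (n : ℕ) × Matrix (Fin n) (Fin n) R, Conj A q.2 :=
  ⟨⟨Fintype.card m, A.submatrix (Fintype.equivFin m).symm (Fintype.equivFin m).symm⟩,
    .submatrix _ A⟩

/-- Exchanging the last two summands of a threefold sum. -/
def Equiv.sumSumRightComm (m n p : Type*) : (m ⊕ n) ⊕ p ≃ (m ⊕ p) ⊕ n :=
  (Equiv.sumAssoc m n p).trans
    (((Equiv.refl m).sumCongr (Equiv.sumComm n p)).trans (Equiv.sumAssoc m p n).symm)

section Commute

variable {m n p : Type*} [Fintype m] [Fintype n] [Fintype p] [DecidableEq m] [DecidableEq n]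
  [DecidableEq p]

theorem Matrix.Conj.row_row (A : Matrix m m R) (X : Matrix n m R) (Y : Matrix p m R) :
    Conj (fromBlocks (fromBlocks A 0 X 0) 0 (fromCols Y 0) 0)
      (fromBlocks (fromBlocks A 0 Y 0) 0 (fromCols X 0) 0) := by
  convert Conj.submatrix (Equiv.sumSumRightComm m p n)
    (fromBlocks (fromBlocks A 0 X 0) 0 (fromCols Y 0) 0) using 1
  ext ((i | i) | i) ((j | j) | j) <;> simp [Equiv.sumSumRightComm]

theorem Matrix.Conj.row_col (A : Matrix m m R) (X : Matrix n m R) (Y : Matrix m p R) :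
    Conj (fromBlocks (fromBlocks A 0 X 0) (fromRows Y 0) 0 0)
      (fromBlocks (fromBlocks A Y 0 0) 0 (fromCols X 0) 0) := by
  convert Conj.submatrix (Equiv.sumSumRightComm m p n)
    (fromBlocks (fromBlocks A 0 X 0) (fromRows Y 0) 0 0) using 1
  ext ((i | i) | i) ((j | j) | j) <;> simp [Equiv.sumSumRightComm]

theorem Matrix.Conj.col_col (A : Matrix m m R) (X : Matrix m n R) (Y : Matrix m p R) :
    Conj (fromBlocks (fromBlocks A X 0 0) (fromRows Y 0) 0 0)
      (fromBlocks (fromBlocks A Y 0 0) (fromRows X 0) 0 0) := by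
  convert Conj.submatrix (Equiv.sumSumRightComm m p n)
    (fromBlocks (fromBlocks A X 0 0) (fromRows Y 0) 0 0) using 1
  ext ((i | i) | i) ((j | j) | j) <;> simp [Equiv.sumSumRightComm]

end Commute

namespace ZeroExt

theorem diamond {p q q' : (n : ℕ) × Matrix (Fin n) (Fin n) R} (h : ZeroExt p q)
    (h' : ZeroExt p q') : ∃ d, ZeroExt q d ∧ ZeroExt q' d := by
  rcases h with ⟨r, X, h⟩ | ⟨r, X, h⟩ <;> rcases h' with ⟨s, Y, h'⟩ | ⟨s, Y, h'⟩
  · obtain ⟨d, hd⟩ := Conj.exists_fin (fromBlocks (fromBlocks p.2 0 X 0) 0 (fromCols Y 0) 0)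
    exact ⟨d, of_row h.symm _ hd, of_row h'.symm _ ((Conj.row_row _ _ _).symm.trans hd)⟩
  · obtain ⟨d, hd⟩ := Conj.exists_fin (fromBlocks (fromBlocks p.2 0 X 0) (fromRows Y 0) 0 0)
    exact ⟨d, of_col h.symm _ hd, of_row h'.symm _ ((Conj.row_col _ _ _).symm.trans hd)⟩
  · obtain ⟨d, hd⟩ := Conj.exists_fin (fromBlocks (fromBlocks p.2 0 Y 0) (fromRows X 0) 0 0)
    exact ⟨d, of_row h.symm _ ((Conj.row_col _ _ _).symm.trans hd), of_col h'.symm _ hd⟩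
  · obtain ⟨d, hd⟩ := Conj.exists_fin (fromBlocks (fromBlocks p.2 X 0 0) (fromRows Y 0) 0 0)
    exact ⟨d, of_col h.symm _ hd, of_col h'.symm _ ((Conj.col_col _ _ _).symm.trans hd)⟩

open Relation

theorem equivalence_join :
    Equivalence (Join (ReflTransGen (ZeroExt (R := R)))) :=
  equivalence_join_reflTransGen fun _ _ _ h h' ↦
    have ⟨d, hd, hd'⟩ := h.diamond h'
    ⟨d, .single hd, .single hd'⟩

theorem join_mul_comm {m n : ℕ} (S : Matrix (Fin m) (Fin n) R) (T : Matrix (Fin n) (Fin m) R) :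
    Join (ReflTransGen ZeroExt) ⟨m, S * T⟩ ⟨n, T * S⟩ := by
  obtain ⟨d, hd⟩ := Conj.exists_fin (fromBlocks (S * T) 0 T 0)
  exact ⟨d, .single (.row n T hd),
    .single (.col m T ((Conj.fromBlocks_mul_swap S T).symm.trans hd))⟩

end ZeroExt

end Extension

section Perron

variable {n : Type*} [Fintype n]

theorem abs_vecMul_pow_le [DecidableEq n] {A : Matrix n n ℝ} (hA : ∀ i j, 0 < A i j)
    {ρ c : ℝ} {l v : n → ℝ}
    (hl : l ᵥ* A = ρ • l) (hv : ∀ i, |v i| ≤ c * l i) (k : ℕ) (j : n) :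
    |(v ᵥ* A ^ k) j| ≤ c * ρ ^ k * l j := by
  induction k generalizing j with
  | zero => simpa using hv j
  | succ k ih =>
    have h : ∑ i, l i * A i j = ρ * l j := congrFun hl j
    rw [pow_succ, ← vecMul_vecMul]
    calc |∑ i, (v ᵥ* A ^ k) i * A i j| ≤ ∑ i, |(v ᵥ* A ^ k) i * A i j| :=
          Finset.abs_sum_le_sum_abs _ _
      _ ≤ ∑ i, c * ρ ^ k * (l i * A i j) := by
          refine Finset.sum_le_sum fun i _ ↦ ?_
          rw [abs_mul, abs_of_pos (hA i j), ← mul_assoc]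
          exact mul_le_mul_of_nonneg_right (ih i) (hA i j).le
      _ = c * ρ ^ (k + 1) * l j := by rw [← Finset.mul_sum, h]; ring

theorem pow_smul_le_vecMul_pow [DecidableEq n] {B : Matrix n n ℝ} (hB : ∀ i j, 0 < B i j)
    {σ : ℝ} (hσ : 0 ≤ σ)
    {y : n → ℝ} (hy : ∀ j, σ * y j ≤ (y ᵥ* B) j) (k : ℕ) (j : n) :
    σ ^ k * y j ≤ (y ᵥ* B ^ k) j := by
  induction k generalizing j with
  | zero => simp
  | succ k ih =>
    rw [pow_succ, pow_succ, ← vecMul_vecMul]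
    calc σ ^ k * σ * y j ≤ σ ^ k * ∑ i, y i * B i j := by
          rw [mul_assoc]; exact mul_le_mul_of_nonneg_left (hy j) (pow_nonneg hσ k)
      _ = ∑ i, σ ^ k * y i * B i j := by rw [Finset.mul_sum]; simp only [mul_assoc]
      _ ≤ ∑ i, (y ᵥ* B ^ k) i * B i j :=
          Finset.sum_le_sum fun i _ ↦ mul_le_mul_of_nonneg_right (ih i) (hB i j).le

theorem eigenvalue_pos {A : Matrix n n ℝ} (hA : ∀ i j, 0 < A i j) {ρ : ℝ} {l : n → ℝ}
    (hl0 : ∀ i, 0 < l i) (hl : l ᵥ* A = ρ • l) (j : n) : 0 < ρ := by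
  have h : ∑ i, l i * A i j = ρ * l j := congrFun hl j
  have : 0 < ∑ i, l i * A i j :=
    Finset.sum_pos (fun i _ ↦ mul_pos (hl0 i) (hA i j)) ⟨j, Finset.mem_univ j⟩
  rw [h] at this
  exact pos_of_mul_pos_left this (hl0 j).le

/-- A subinvariance growth rate of a positive matrix is at most the eigenvalue of any positive
eigenvector of a conjugate positive matrix. -/
theorem growth_le_eigenvalue [DecidableEq n] {A B P Q : Matrix n n ℝ} (hA : ∀ i j, 0 < A i j)
    (hB : ∀ i j, 0 < B i j) (hQP : Q * P = 1) (hAP : A * P = P * B) {ρ σ : ℝ} {l y : n → ℝ}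
    (hl0 : ∀ i, 0 < l i) (hl : l ᵥ* A = ρ • l) {j : n} (hyj : 0 < y j)
    (hy : ∀ j, σ * y j ≤ (y ᵥ* B) j) : σ ≤ ρ := by
  by_contra! hlt
  have hρ := eigenvalue_pos hA hl0 hl j
  have hpow (k : ℕ) : A ^ k * P = P * B ^ k := by
    induction k with
    | zero => simp
    | succ k ih => rw [pow_succ, Matrix.mul_assoc, hAP, ← Matrix.mul_assoc, ih, Matrix.mul_assoc,
        ← pow_succ]
  set v := y ᵥ* Q
  obtain ⟨c, hc⟩ : ∃ c, ∀ i, |v i| ≤ c * l i := by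
    refine ⟨∑ i, |v i| / l i, fun i ↦ ?_⟩
    rw [← div_le_iff₀ (hl0 i)]
    exact Finset.single_le_sum (f := fun i ↦ |v i| / l i)
      (fun i _ ↦ div_nonneg (abs_nonneg _) (hl0 i).le) (Finset.mem_univ i)
  set K := ∑ i, c * l i * |P i j|
  have key (k : ℕ) : σ ^ k * y j ≤ ρ ^ k * K := by
    have h1 : y ᵥ* B ^ k = (v ᵥ* A ^ k) ᵥ* P := by
      rw [vecMul_vecMul, hpow, vecMul_vecMul, ← Matrix.mul_assoc, hQP, Matrix.one_mul]
    calc σ ^ k * y j ≤ (y ᵥ* B ^ k) j := pow_smul_le_vecMul_pow hB (hρ.trans hlt).le hy k j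
      _ = ∑ i, (v ᵥ* A ^ k) i * P i j := by rw [h1]; rfl
      _ ≤ ∑ i, c * ρ ^ k * l i * |P i j| := by
          refine Finset.sum_le_sum fun i _ ↦ (le_abs_self _).trans ?_
          rw [abs_mul]
          exact mul_le_mul_of_nonneg_right (abs_vecMul_pow_le hA hl hc k i) (abs_nonneg _)
      _ = ρ ^ k * K := by
          rw [Finset.mul_sum]; exact Finset.sum_congr rfl fun i _ ↦ by ring
  obtain ⟨k, hk⟩ := pow_unbounded_of_one_lt (K / y j) ((one_lt_div hρ).2 hlt)
  rw [div_pow, div_lt_div_iff₀ hyj (pow_pos hρ k)] at hk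
  linarith [key k]

/-- Conjugacies between positive matrices send positive eigenvectors to vectors of constant
sign. -/
theorem vecMul_pos_or_neg [DecidableEq n] {A B P Q : Matrix n n ℝ} (hA : ∀ i j, 0 < A i j)
    (hB : ∀ i j, 0 < B i j) (hPQ : P * Q = 1) (hQP : Q * P = 1) (hAP : A * P = P * B) {ρ : ℝ}
    {l : n → ℝ} (hl0 : ∀ i, 0 < l i) (hl : l ᵥ* A = ρ • l) :
    (∀ i, 0 < (l ᵥ* P) i) ∨ ∀ i, (l ᵥ* P) i < 0 := by
  rcases isEmpty_or_nonempty n with _ | ⟨⟨j₀⟩⟩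
  · exact .inl isEmptyElim
  have hρ := eigenvalue_pos hA hl0 hl j₀
  set x := l ᵥ* P with hx
  have hxB : x ᵥ* B = ρ • x := by
    rw [hx, vecMul_vecMul, ← hAP, ← vecMul_vecMul, hl, smul_vecMul]
  have hxB' (j : n) : ∑ i, x i * B i j = ρ * x j := congrFun hxB j
  obtain ⟨i₀, hi₀⟩ : ∃ i, x i ≠ 0 := by
    by_contra! h
    have h1 : l = x ᵥ* Q := by rw [hx, vecMul_vecMul, hPQ, vecMul_one]
    have h2 : x = 0 := funext h
    have := hl0 j₀
    simp [h1, h2] at this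
  by_cases hpos : ∀ i, 0 ≤ x i
  · refine .inl fun j ↦ pos_of_mul_pos_right (a := ρ) ?_ hρ.le
    rw [← hxB']
    exact Finset.sum_pos' (fun i _ ↦ mul_nonneg (hpos i) (hB i j).le)
      ⟨i₀, Finset.mem_univ _, mul_pos ((hpos i₀).lt_of_ne' hi₀) (hB _ _)⟩
  by_cases hneg : ∀ i, x i ≤ 0
  · refine .inr fun j ↦ neg_of_mul_neg_right (a := ρ) ?_ hρ.le
    rw [← hxB']
    exact Finset.sum_neg' (fun i _ ↦ mul_nonpos_of_nonpos_of_nonneg (hneg i) (hB i j).le)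
      ⟨i₀, Finset.mem_univ _, mul_neg_of_neg_of_pos ((hneg i₀).lt_of_ne hi₀) (hB _ _)⟩
  push Not at hpos hneg
  obtain ⟨i₁, hi₁⟩ := hpos
  obtain ⟨i₂, hi₂⟩ := hneg
  have hstrict (j : n) : ρ * |x j| < (|x| ᵥ* B) j := by
    change _ < ∑ i, |x i| * B i j
    have h1 : ∑ i, x i * B i j < ∑ i, |x i| * B i j :=
      Finset.sum_lt_sum (fun i _ ↦ mul_le_mul_of_nonneg_right (le_abs_self _) (hB i j).le)
        ⟨i₁, Finset.mem_univ _, mul_lt_mul_of_pos_right (hi₁.trans (abs_pos.2 hi₁.ne)) (hB _ _)⟩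
    have h2 : ∑ i, -x i * B i j < ∑ i, |x i| * B i j :=
      Finset.sum_lt_sum (fun i _ ↦ mul_le_mul_of_nonneg_right (neg_le_abs _) (hB i j).le)
        ⟨i₂, Finset.mem_univ _, mul_lt_mul_of_pos_right
          ((neg_neg_of_pos hi₂).trans (abs_pos.2 hi₂.ne')) (hB _ _)⟩
    simp only [neg_mul, Finset.sum_neg_distrib] at h2
    rw [hxB'] at h1 h2
    rcases abs_cases (x j) with ⟨h, -⟩ | ⟨h, -⟩ <;> rw [h] <;> linarith
  have hev : ∀ᶠ σ in nhdsWithin ρ (Set.Ioi ρ), ∀ j, σ * |x j| < (|x| ᵥ* B) j :=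
    nhdsWithin_le_nhds <| Filter.eventually_all.2 fun j ↦
      (continuous_id.mul continuous_const).continuousAt.eventually_lt continuousAt_const (hstrict j)
  obtain ⟨σ, hσ, hρσ⟩ := (hev.and self_mem_nhdsWithin).exists
  exact absurd (growth_le_eigenvalue hA hB hQP hAP hl0 hl (y := |x|) (abs_pos.2 hi₂.ne')
    fun j ↦ (hσ j).le) (not_le.2 hρσ)

theorem eigenvalue_unique {A : Matrix n n ℝ} (hA : ∀ i j, 0 < A i j) {ρ ρ' : ℝ} {l l' : n → ℝ}
    (hl0 : ∀ i, 0 < l i) (hl : l ᵥ* A = ρ • l) (hl0' : ∀ i, 0 < l' i) (hl' : l' ᵥ* A = ρ' • l')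
    (j : n) : ρ = ρ' := by
  classical
  exact le_antisymm
    (growth_le_eigenvalue hA hA (one_mul 1) (by simp) hl0' hl' (hl0 j) fun j ↦ (congrFun hl j).ge)
    (growth_le_eigenvalue hA hA (one_mul 1) (by simp) hl0 hl (hl0' j) fun j ↦ (congrFun hl' j).ge)

theorem vecMul_forall_pos_or_forall_neg [DecidableEq n] {A B P Q : Matrix n n ℝ}
    (hA : ∀ i j, 0 < A i j) (hB : ∀ i j, 0 < B i j) (hPQ : P * Q = 1) (hQP : Q * P = 1)
    (hAP : A * P = P * B) :
    (∀ (ρ : ℝ) (l : n → ℝ), (∀ i, 0 < l i) → l ᵥ* A = ρ • l → ∀ i, 0 < (l ᵥ* P) i) ∨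
      ∀ (ρ : ℝ) (l : n → ℝ), (∀ i, 0 < l i) → l ᵥ* A = ρ • l → ∀ i, (l ᵥ* P) i < 0 := by
  by_contra! ⟨⟨ρ, l, hl0, hl, i, hi⟩, ρ', l', hl0', hl', i', hi'⟩
  have hlneg := (vecMul_pos_or_neg hA hB hPQ hQP hAP hl0 hl).resolve_left fun h ↦
    hi.not_gt (h i)
  have hlpos := (vecMul_pos_or_neg hA hB hPQ hQP hAP hl0' hl').resolve_right fun h ↦
    hi'.not_gt (h i')
  obtain rfl := eigenvalue_unique hA hl0 hl hl0' hl' i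
  have h0 : ((l' ᵥ* P) i • l + (-(l ᵥ* P) i) • l') ᵥ* P =
      (l' ᵥ* P) i • (l ᵥ* P) + (-(l ᵥ* P) i) • (l' ᵥ* P) := by
    rw [add_vecMul, smul_vecMul, smul_vecMul]
  have := vecMul_pos_or_neg hA hB hPQ hQP hAP
    (l := (l' ᵥ* P) i • l + (-(l ᵥ* P) i) • l') (ρ := ρ)
    (fun j ↦ add_pos (mul_pos (hlpos i) (hl0 j)) (mul_pos (neg_pos.2 (hlneg i)) (hl0' j)))
    (by rw [add_vecMul, smul_vecMul, smul_vecMul, hl, hl', smul_add, smul_comm, smul_comm _ ρ])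
  rw [h0] at this
  rcases this with h | h <;> exact absurd (h i) (by simp [mul_comm])

end Perron

section Positivity

/-- Elementary strong shift equivalence by entrywise nonnegative matrices, for arbitrary index
types. -/
def NonnegESSE {R m n : Type*} [CommRing R] [LE R] [Fintype m] [Fintype n] (A : Matrix m m R)
    (B : Matrix n n R) : Prop :=
  ∃ (S : Matrix m n R) (T : Matrix n m R),
    (∀ i j, 0 ≤ S i j) ∧ (∀ i j, 0 ≤ T i j) ∧ A = S * T ∧ B = T * S

namespace NonnegESSE

variable {R m n p : Type*} [CommRing R] [LE R] [Fintype m] [Fintype n] [Fintype p]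

theorem transpose {A : Matrix m m R} {B : Matrix n n R} (h : NonnegESSE A B) :
    NonnegESSE Aᵀ Bᵀ := by
  obtain ⟨S, T, hS, hT, rfl, rfl⟩ := h
  exact ⟨Tᵀ, Sᵀ, fun i j ↦ hT j i, fun i j ↦ hS j i, transpose_mul S T, transpose_mul T S⟩

theorem reindex {A : Matrix m m R} {B : Matrix n n R} (h : NonnegESSE A B) (e : p ≃ n) :
    NonnegESSE A (B.submatrix e e) := by
  obtain ⟨S, T, hS, hT, rfl, rfl⟩ := h
  exact ⟨S.submatrix id e, T.submatrix e id, fun i j ↦ hS i (e j), fun i j ↦ hT (e i) j,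
    by rw [submatrix_mul_equiv, submatrix_id_id],
    submatrix_mul _ _ _ _ _ Function.bijective_id⟩

end NonnegESSE

theorem Matrix.Conj.row_shear {R m p : Type*} [CommRing R] [Fintype m] [Fintype p] [DecidableEq m]
    [DecidableEq p] (C : Matrix m m R) (X Y : Matrix p m R) (Z : Matrix m p R) :
    Conj (fromBlocks C 0 X 0)
      (fromRows (C - Z * (X + Y * C)) (X + Y * C) * fromCols (1 : Matrix m m R) Z) := by
  have h₁ : Conj (fromBlocks C 0 X 0) (fromBlocks C 0 (X + Y * C) 0) := by
    refine ⟨fromBlocks 1 0 (-Y) 1, fromBlocks 1 0 Y 1, ?_, ?_, ?_⟩ <;>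
      simp [fromBlocks_multiply]
  refine h₁.trans ⟨fromBlocks 1 Z 0 1, fromBlocks 1 (-Z) 0 1, ?_, ?_, ?_⟩ <;>
    simp [fromBlocks_multiply, Matrix.mul_assoc, Matrix.sub_mul]

variable {U : Subring ℝ} {m p : Type*} [Fintype m] [Fintype p]

theorem Subring.exists_pos_mul_lt (hU : Dense (U : Set ℝ)) (s : m → U) (C : Matrix m m U)
    (hC : ∀ i j, 0 < C i j) : ∃ ε : U, 0 < ε ∧ ∀ i j, ε * s j < C i j := by
  have hev : ∀ᶠ x in nhdsWithin (0 : ℝ) (Set.Ioi 0), ∀ i j, x * (s j : ℝ) < C i j :=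
    nhdsWithin_le_nhds <| Filter.eventually_all.2 fun i ↦ Filter.eventually_all.2 fun j ↦
      (continuous_id.mul continuous_const).continuousAt.eventually_lt continuousAt_const
        (show (0 : ℝ) * s j < C i j by rw [zero_mul]; exact hC i j)
  obtain ⟨δ, hδ, h⟩ := mem_nhdsGT_iff_exists_Ioo_subset.1 hev
  obtain ⟨ε, hεU, hε⟩ := hU.exists_between (show (0 : ℝ) < δ from hδ)
  exact ⟨⟨ε, hεU⟩, hε.1, fun i j ↦ h hε i j⟩

theorem Subring.exists_nat_mul_add_pos (s : m → U) (hs : ∀ j, 0 < s j) (X : Matrix p m U) :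
    ∃ N : ℕ, ∀ i j, 0 < X i j + N * s j := by
  have hev : ∀ᶠ N : ℕ in Filter.atTop, ∀ i j, 0 < X i j + N * s j := by
    refine Filter.eventually_all.2 fun i ↦ Filter.eventually_all.2 fun j ↦ ?_
    have hs' : (0 : ℝ) < s j := hs j
    filter_upwards [Filter.eventually_gt_atTop ⌈-(X i j : ℝ) / s j⌉₊] with N hN
    have h := (div_lt_iff₀ hs').1 (Nat.lt_of_ceil_lt hN)
    have : (0 : ℝ) < X i j + N * s j := by linarith
    exact_mod_cast this
  exact hev.exists

theorem exists_pos_conj_row [DecidableEq m] [DecidableEq p] [Nonempty m] (hU : Dense (U : Set ℝ))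
    (C : Matrix m m U) (hC : ∀ i j, 0 < C i j) (X : Matrix p m U) :
    ∃ D : Matrix (m ⊕ p) (m ⊕ p) U, (∀ i j, 0 < D i j) ∧ Conj (fromBlocks C 0 X 0) D ∧
      NonnegESSE C D := by
  obtain ⟨N, hN⟩ := U.exists_nat_mul_add_pos (fun j ↦ ∑ i, C i j)
    (fun j ↦ Finset.sum_pos (fun i _ ↦ hC i j) Finset.univ_nonempty) X
  set Y : Matrix p m U := of fun _ _ ↦ (N : U)
  have hX : ∀ i j, 0 < (X + Y * C) i j := fun i j ↦ by
    simpa [Y, Matrix.mul_apply, Finset.mul_sum] using hN i j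
  set X' := X + Y * C
  obtain ⟨ε, hε, hεC⟩ := U.exists_pos_mul_lt hU (fun j ↦ ∑ i, X' i j) C hC
  set Z : Matrix m p U := of fun _ _ ↦ ε
  have hCZ : ∀ i j, 0 < (C - Z * X') i j := fun i j ↦ by
    simpa [Z, Matrix.mul_apply, Finset.mul_sum] using hεC i j
  have hS : ∀ i j, 0 < fromRows (C - Z * X') X' i j := by
    rintro (i | i) j
    exacts [hCZ i j, hX i j]
  have hT : ∀ i j, 0 ≤ fromCols (1 : Matrix m m U) Z i j := by
    rintro i (j | j)
    · rw [fromCols_apply_inl, one_apply]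
      split_ifs <;> simp
    · exact hε.le
  refine ⟨_, ?_, Conj.row_shear C X Y Z, fromCols 1 Z, fromRows (C - Z * X') X', hT,
    fun i j ↦ (hS i j).le, ?_, rfl⟩
  · intro i j
    refine Finset.sum_pos' (fun k _ ↦ mul_nonneg (hS i k).le (hT k j)) ?_
    rcases j with j | j
    · exact ⟨j, Finset.mem_univ _, mul_pos (hS i j) (by simp)⟩
    · exact ⟨Classical.arbitrary m, Finset.mem_univ _, mul_pos (hS i _) hε⟩
  · simp [fromCols_mul_fromRows]

theorem exists_pos_conj_col [DecidableEq m] [DecidableEq p] [Nonempty m] (hU : Dense (U : Set ℝ))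
    (C : Matrix m m U) (hC : ∀ i j, 0 < C i j) (X : Matrix m p U) :
    ∃ D : Matrix (m ⊕ p) (m ⊕ p) U, (∀ i j, 0 < D i j) ∧ Conj (fromBlocks C X 0 0) D ∧
      NonnegESSE C D := by
  obtain ⟨D, hD, h₁, h₂⟩ := exists_pos_conj_row hU Cᵀ (fun i j ↦ hC j i) Xᵀ
  refine ⟨Dᵀ, fun i j ↦ hD j i, ?_, h₂.transpose⟩
  simpa [fromBlocks_transpose] using h₁.transpose

theorem ZeroExt.exists_pos {q r : (n : ℕ) × Matrix (Fin n) (Fin n) U} [Nonempty m] [DecidableEq m]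
    (hU : Dense (U : Set ℝ)) (h : ZeroExt q r) {C : Matrix m m U} (hC : ∀ i j, 0 < C i j)
    (hCq : Conj C q.2) :
    ∃ D : Matrix (Fin r.1) (Fin r.1) U, (∀ i j, 0 < D i j) ∧ Conj D r.2 ∧ NonnegESSE C D := by
  obtain ⟨s, D, hD, hDr, hCD⟩ : ∃ (s : ℕ) (D : Matrix (m ⊕ Fin s) (m ⊕ Fin s) U),
      (∀ i j, 0 < D i j) ∧ Conj D r.2 ∧ NonnegESSE C D := by
    rcases h with ⟨s, X, h⟩ | ⟨s, X, h⟩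
    · obtain ⟨Y, hY⟩ := hCq.fromBlocks_row X
      obtain ⟨D, hD, h₁, h₂⟩ := exists_pos_conj_row hU C hC Y
      exact ⟨s, D, hD, h₁.symm.trans (hY.trans h), h₂⟩
    · obtain ⟨Y, hY⟩ := hCq.fromBlocks_col X
      obtain ⟨D, hD, h₁, h₂⟩ := exists_pos_conj_col hU C hC Y
      exact ⟨s, D, hD, h₁.symm.trans (hY.trans h), h₂⟩
  let e := (Fintype.equivOfCardEq hDr.card_eq).symm
  exact ⟨D.submatrix e e, fun i j ↦ hD _ _, (Conj.submatrix e D).symm.trans hDr, hCD.reindex e⟩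

theorem NonnegESSE.esse {m n : ℕ} {A : Matrix (Fin m) (Fin m) U} {B : Matrix (Fin n) (Fin n) U}
    (h : NonnegESSE A B) :
    ESSE {x : ℝ | x ∈ U ∧ 0 ≤ x} ⟨m, A.map U.subtype⟩ ⟨n, B.map U.subtype⟩ := by
  obtain ⟨S, T, hS, hT, rfl, rfl⟩ := h
  exact ⟨S.map U.subtype, T.map U.subtype, fun i j ↦ ⟨(S i j).2, hS i j⟩,
    fun i j ↦ ⟨(T i j).2, hT i j⟩, Matrix.map_mul, Matrix.map_mul⟩

open Relation

theorem exists_pos_of_reflTransGen (hU : Dense (U : Set ℝ)) {n : ℕ} [NeZero n]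
    {A : Matrix (Fin n) (Fin n) U} (hA : ∀ i j, 0 < A i j)
    {q : (n : ℕ) × Matrix (Fin n) (Fin n) U} (h : ReflTransGen ZeroExt ⟨n, A⟩ q) :
    NeZero q.1 ∧ ∃ D : Matrix (Fin q.1) (Fin q.1) U, (∀ i j, 0 < D i j) ∧ Conj D q.2 ∧
      SSE {x : ℝ | x ∈ U ∧ 0 ≤ x} ⟨n, A.map U.subtype⟩ ⟨q.1, D.map U.subtype⟩ := by
  induction h with
  | refl => exact ⟨‹_›, A, hA, .refl A, .refl⟩
  | @tail q r _ hqr ih =>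
    obtain ⟨hq, C, hC, hCq, hAC⟩ := ih
    obtain ⟨D, hD, hDr, hCD⟩ := hqr.exists_pos hU hC hCq
    refine ⟨⟨?_⟩, D, hD, hDr, hAC.tail hCD.esse⟩
    have : q.1 ≤ r.1 := by
      rcases hqr with ⟨s, X, h⟩ | ⟨s, X, h⟩ <;>
      · have := h.card_eq
        simp only [Fintype.card_sum, Fintype.card_fin] at this
        omega
    have := hq.out
    omega

end Positivity

section StrongShiftEquivalence

open Relation

variable {U : Subring ℝ}

theorem entriesIn.exists_map {m n : ℕ} {A : Matrix (Fin m) (Fin n) ℝ}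
    (hA : entriesIn (U : Set ℝ) A) : ∃ A₀ : Matrix (Fin m) (Fin n) U, A₀.map U.subtype = A :=
  ⟨of fun i j ↦ ⟨A i j, hA i j⟩, rfl⟩

theorem entriesIn_map {m n : ℕ} (A : Matrix (Fin m) (Fin n) U) :
    entriesIn (U : Set ℝ) (A.map U.subtype) :=
  fun i j ↦ (A i j).2

theorem SSE.join_zeroExt {p q : (n : ℕ) × Matrix (Fin n) (Fin n) ℝ} (h : SSE (U : Set ℝ) p q)
    {A : Matrix (Fin p.1) (Fin p.1) U} (hA : A.map U.subtype = p.2) :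
    ∃ B : Matrix (Fin q.1) (Fin q.1) U, B.map U.subtype = q.2 ∧
      Join (ReflTransGen ZeroExt) ⟨p.1, A⟩ ⟨q.1, B⟩ := by
  induction h with
  | refl => exact ⟨A, hA, ZeroExt.equivalence_join.refl _⟩
  | tail _ h ih =>
    obtain ⟨B, hB, hAB⟩ := ih
    obtain ⟨S, T, hS, hT, h₁, h₂⟩ := h
    obtain ⟨S, rfl⟩ := hS.exists_map
    obtain ⟨T, rfl⟩ := hT.exists_map
    rw [← hB, ← Matrix.map_mul] at h₁
    obtain rfl := Matrix.map_injective U.subtype_injective h₁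
    exact ⟨T * S, by rw [h₂, Matrix.map_mul],
      ZeroExt.equivalence_join.trans hAB (ZeroExt.join_mul_comm S T)⟩

theorem SSE.trace_eq {S : Set ℝ} {p q : (n : ℕ) × Matrix (Fin n) (Fin n) ℝ} (h : SSE S p q) :
    p.2.trace = q.2.trace := by
  induction h with
  | refl => rfl
  | tail _ h ih =>
    obtain ⟨R, T, -, -, h₁, h₂⟩ := h
    rw [ih, h₁, h₂, trace_mul_comm]

theorem PosEntries.trace_pos {n : ℕ} [NeZero n] {A : Matrix (Fin n) (Fin n) ℝ}
    (hA : PosEntries A) : 0 < A.trace :=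
  Finset.sum_pos (fun i _ ↦ hA i i) Finset.univ_nonempty


theorem exists_conj_vecMul_pos {n : ℕ} {A B : Matrix (Fin n) (Fin n) U} (hA : ∀ i j, 0 < A i j)
    (hB : ∀ i j, 0 < B i j) (h : Conj A B) :
    ∃ P Q : Matrix (Fin n) (Fin n) U, P * Q = 1 ∧ Q * P = 1 ∧ A * P = P * B ∧
      ∀ (ρ : ℝ) (l : Fin n → ℝ), (∀ i, 0 < l i) → l ᵥ* A.map U.subtype = ρ • l →
        ∀ i, 0 < (l ᵥ* P.map U.subtype) i := by
  obtain ⟨P, Q, hPQ, hQP, hAP⟩ := h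
  have hmap {X Y Z T : Matrix (Fin n) (Fin n) U} (h : X * Y = Z * T) :
      X.map U.subtype * Y.map U.subtype = Z.map U.subtype * T.map U.subtype := by
    rw [← Matrix.map_mul, h, Matrix.map_mul]
  have hone {X Y : Matrix (Fin n) (Fin n) U} (h : X * Y = 1) :
      X.map U.subtype * Y.map U.subtype = 1 := by
    rw [← Matrix.map_mul, h, Matrix.map_one _ (map_zero _) (map_one _)]
  rcases vecMul_forall_pos_or_forall_neg (A := A.map U.subtype) (B := B.map U.subtype)
    hA hB (hone hPQ) (hone hQP) (hmap hAP) with h | h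
  · exact ⟨P, Q, hPQ, hQP, hAP, h⟩
  · refine ⟨-P, -Q, by simpa, by simpa, by simpa, fun ρ l hl0 hl i ↦ ?_⟩
    have hneg : (-P).map U.subtype = -P.map U.subtype := by ext; simp
    rw [hneg, vecMul_neg, Pi.neg_apply, neg_pos]
    exact h ρ l hl0 hl i

/-- A conjugacy preserving positivity of positive eigenvectors can be given positive determinant,
after a permutation of the indices of the target. -/
theorem exists_conj_det_pos {n : ℕ} {A B : Matrix (Fin n) (Fin n) U} (hA : ∀ i j, 0 < A i j)
    (hB : ∀ i j, 0 < B i j) (h : Conj A B) :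
    ∃ B' P Q : Matrix (Fin n) (Fin n) U, (∀ i j, 0 < B' i j) ∧ NonnegESSE B B' ∧
      P * Q = 1 ∧ Q * P = 1 ∧ A * P = P * B' ∧ 0 < (P.map U.subtype).det ∧
      ∀ (ρ : ℝ) (l : Fin n → ℝ), (∀ i, 0 < l i) → l ᵥ* A.map U.subtype = ρ • l →
        ∀ i, 0 < (l ᵥ* P.map U.subtype) i := by
  obtain ⟨P, Q, hPQ, hQP, hAP, hl⟩ := exists_conj_vecMul_pos hA hB h
  have hBB : NonnegESSE B B := by
    refine ⟨1, B, fun i j ↦ ?_, fun i j ↦ (hB i j).le, by simp, by simp⟩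
    rw [one_apply]
    split_ifs <;> simp
  rcases lt_trichotomy (P.map U.subtype).det 0 with hdet | hdet | hdet
  · obtain ⟨i, j, hij⟩ : ∃ i j : Fin n, i ≠ j := by
      by_contra! hsub
      have : Subsingleton (Fin n) := ⟨hsub⟩
      rcases isEmpty_or_nonempty (Fin n) with _ | ⟨⟨i⟩⟩
      · norm_num [det_isEmpty] at hdet
      rw [det_eq_elem_of_subsingleton _ i] at hdet
      have : Unique (Fin n) := ⟨⟨i⟩, fun j ↦ hsub j i⟩
      have h1 := hl (A i i) 1 (fun _ ↦ one_pos) (by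
        ext j
        simp [hsub j i, vecMul, dotProduct, hsub default i]) i
      simp [vecMul, dotProduct, hsub default i] at h1 hdet
      exact h1.not_gt hdet
    set e := Equiv.swap i j
    have hid {X Y : Matrix (Fin n) (Fin n) U} :
        X.submatrix id e * Y.submatrix e id = X * Y := by
      rw [submatrix_mul_equiv, submatrix_id_id]
    refine ⟨B.submatrix e e, P.submatrix id e, Q.submatrix e id, fun _ _ ↦ hB _ _,
      hBB.reindex e, hid.trans hPQ, ?_, ?_, ?_, fun ρ l hl0 hlA k ↦ hl ρ l hl0 hlA (e k)⟩
    · rw [← submatrix_mul _ _ _ _ _ Function.bijective_id, hQP, submatrix_one_equiv]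
    · rw [submatrix_mul_equiv, ← hAP, submatrix_mul _ _ _ _ _ Function.bijective_id,
        submatrix_id_id]
    · rw [← submatrix_map, det_permute', Equiv.Perm.sign_swap hij]
      simpa using hdet
  · have h1 : P.map U.subtype * Q.map U.subtype = 1 := by
      rw [← Matrix.map_mul, hPQ, Matrix.map_one _ (map_zero _) (map_one _)]
    exact absurd (congrArg det h1) (by simp only [det_mul, hdet]; simp)
  · exact ⟨B, P, Q, hB, hBB, hPQ, hQP, hAP, hdet, hl⟩

end StrongShiftEquivalence

/-- Theorem: positive matrices over a nondiscrete unital subring `U` of `ℝ` which are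
strong shift equivalent over `U` are strong shift equivalent over `U₊` to positive
matrices which are conjugate over `U`, where the conjugating matrix has positive
determinant and sends positive (Perron) left eigenvectors to positive vectors. -/
theorem sse_to_conjugacy (U : Subring ℝ) (hU : Dense (U : Set ℝ))
    {m k : ℕ} (A : Matrix (Fin m) (Fin m) ℝ) (B : Matrix (Fin k) (Fin k) ℝ)
    (hAU : entriesIn (U : Set ℝ) A) (hBU : entriesIn (U : Set ℝ) B)
    (hApos : PosEntries A) (hBpos : PosEntries B)
    (hsse : SSE (U : Set ℝ) ⟨m, A⟩ ⟨k, B⟩) :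
    ∃ (n : ℕ) (A' B' W Winv : Matrix (Fin n) (Fin n) ℝ),
      PosEntries A' ∧ PosEntries B' ∧
      entriesIn (U : Set ℝ) A' ∧ entriesIn (U : Set ℝ) B' ∧
      SSE {x : ℝ | x ∈ U ∧ 0 ≤ x} ⟨m, A⟩ ⟨n, A'⟩ ∧
      SSE {x : ℝ | x ∈ U ∧ 0 ≤ x} ⟨k, B⟩ ⟨n, B'⟩ ∧
      entriesIn (U : Set ℝ) W ∧ entriesIn (U : Set ℝ) Winv ∧
      W * Winv = 1 ∧ Winv * W = 1 ∧ Winv * A' * W = B' ∧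
      0 < W.det ∧
      ∀ (ρ : ℝ) (ℓ : Fin n → ℝ), (∀ i, 0 < ℓ i) →
        Matrix.vecMul ℓ A' = ρ • ℓ → ∀ i, 0 < Matrix.vecMul ℓ W i := by
  have htr : A.trace = B.trace := hsse.trace_eq
  rcases Nat.eq_zero_or_pos m with rfl | hm
  · obtain rfl : k = 0 := by
      by_contra hk
      have : NeZero k := ⟨hk⟩
      exact hBpos.trace_pos.ne (by rw [← htr, trace_eq_zero_of_isEmpty])
    obtain rfl : A = B := Subsingleton.elim _ _
    exact ⟨0, A, A, 1, 1, hApos, hApos, hAU, hAU, .refl, .refl, isEmptyElim, isEmptyElim,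
      Subsingleton.elim _ _, Subsingleton.elim _ _, Subsingleton.elim _ _, by simp,
      fun _ _ _ _ ↦ isEmptyElim⟩
  have : NeZero m := ⟨hm.ne'⟩
  have : NeZero k := by
    refine ⟨?_⟩
    rintro rfl
    exact hApos.trace_pos.ne' (by rw [htr, trace_eq_zero_of_isEmpty])
  obtain ⟨A, rfl⟩ := hAU.exists_map
  obtain ⟨(B₀ : Matrix (Fin k) (Fin k) U), (hB₀ : B₀.map U.subtype = B), ⟨n, F⟩, hAF, hBF⟩ :=
    hsse.join_zeroExt rfl
  subst hB₀
  obtain ⟨-, A', hA', hA'F, hAA'⟩ := exists_pos_of_reflTransGen hU hApos hAF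
  obtain ⟨-, B', hB', hB'F, hBB'⟩ := exists_pos_of_reflTransGen hU hBpos hBF
  obtain ⟨B'', P, Q, hB'', hB'B'', hPQ, hQP, hAP, hdet, hl⟩ :=
    exists_conj_det_pos hA' hB' (hA'F.trans hB'F.symm)
  refine ⟨n, A'.map U.subtype, B''.map U.subtype, P.map U.subtype, Q.map U.subtype, hA', hB'',
    entriesIn_map _, entriesIn_map _, hAA', hBB'.tail hB'B''.esse, entriesIn_map _,
    entriesIn_map _, ?_, ?_, ?_, hdet, hl⟩
  · rw [← Matrix.map_mul, hPQ, Matrix.map_one _ (map_zero _) (map_one _)]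
  · rw [← Matrix.map_mul, hQP, Matrix.map_one _ (map_zero _) (map_one _)]
  · rw [← Matrix.map_mul, ← Matrix.map_mul, Matrix.mul_assoc, hAP, ← Matrix.mul_assoc, hQP,
      Matrix.one_mul]
end

section
/- Let U be a nondiscrete unital subring of ℝ. Suppose A and C are n×n matrices over U, W is an n×n matrix invertible over U with W⁻¹AW = C, and C' is obtained from C by a finite sequence of elementary row splittings over U. If A is a positive matrix, then there is a positive matrix A⁺ over U which is obtained from A by a finite sequence of elementary row splittings over U₊ in which every intermediate matrix is positive, and such that A⁺ is conjugate over U to the block-diagonal matrix with blocks C' and a square zero matrix. -/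
open Matrix

/-- An amalgamation matrix: a 0-1 matrix with exactly one 1 in each row and at
least one 1 in each column. -/
def IsAmalgamation {m n : ℕ} (V : Matrix (Fin m) (Fin n) ℝ) : Prop :=
  (∀ i j, V i j = 0 ∨ V i j = 1) ∧ (∀ i, ∃! j, V i j = 1) ∧ (∀ j, ∃ i, V i j = 1)

/-- A subdivision matrix is the transpose of an amalgamation matrix. -/
def IsSubdivision {m n : ℕ} (U₀ : Matrix (Fin m) (Fin n) ℝ) : Prop :=
  IsAmalgamation U₀ᵀ

/-- `q` is obtained from `p` by an elementary row splitting over `S`. -/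
def RowSplitting (S : Set ℝ) (p q : (n : ℕ) × Matrix (Fin n) (Fin n) ℝ) : Prop :=
  ∃ (U₀ : Matrix (Fin p.1) (Fin q.1) ℝ) (X : Matrix (Fin q.1) (Fin p.1) ℝ),
    IsSubdivision U₀ ∧ entriesIn S U₀ ∧ entriesIn S X ∧ p.2 = U₀ * X ∧ q.2 = X * U₀

/-- Conjugacy over a subset `S` of `ℝ`: there is a matrix `W`, invertible with `W` and
`W⁻¹` having entries in `S`, with `W⁻¹ A W = B`. -/
def ConjOver {n : ℕ} (S : Set ℝ) (A B : Matrix (Fin n) (Fin n) ℝ) : Prop :=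
  ∃ W Winv : Matrix (Fin n) (Fin n) ℝ, entriesIn S W ∧ entriesIn S Winv ∧
    W * Winv = 1 ∧ Winv * W = 1 ∧ Winv * A * W = B

section Similarity

variable {R : Type*} [CommRing R] {m n l l' o : Type*} [Fintype m] [Fintype n] [Fintype l]
  [Fintype l'] [Fintype o] [DecidableEq m] [DecidableEq n] [DecidableEq l] [DecidableEq l']
  [DecidableEq o]

/-- Similarity over `R` of square matrices whose index types may differ. -/
def MatrixSimilar (A : Matrix m m R) (B : Matrix n n R) : Prop :=
  ∃ (P : Matrix m n R) (Q : Matrix n m R), P * Q = 1 ∧ Q * P = 1 ∧ Q * A * P = B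

lemma MatrixSimilar.symm {A : Matrix m m R} {B : Matrix n n R} (h : MatrixSimilar A B) : MatrixSimilar B A := by
  obtain ⟨P, Q, hPQ, hQP, rfl⟩ := h
  refine ⟨Q, P, hQP, hPQ, ?_⟩
  rw [← Matrix.mul_assoc, ← Matrix.mul_assoc, hPQ, Matrix.one_mul, Matrix.mul_assoc, hPQ,
    Matrix.mul_one]

lemma MatrixSimilar.trans {A : Matrix m m R} {B : Matrix n n R} {C : Matrix o o R}
    (h : MatrixSimilar A B) (h' : MatrixSimilar B C) : MatrixSimilar A C := by
  obtain ⟨P, Q, hPQ, hQP, rfl⟩ := h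
  obtain ⟨P', Q', hPQ', hQP', rfl⟩ := h'
  refine ⟨P * P', Q' * Q, ?_, ?_, by simp only [Matrix.mul_assoc]⟩
  · rw [Matrix.mul_assoc, ← Matrix.mul_assoc P', hPQ', Matrix.one_mul, hPQ]
  · rw [Matrix.mul_assoc, ← Matrix.mul_assoc Q, hQP, Matrix.one_mul, hQP']

lemma similar_submatrix (A : Matrix m m R) (e : n ≃ m) : MatrixSimilar A (A.submatrix e e) := by
  refine ⟨(1 : Matrix m m R).submatrix id e, (1 : Matrix m m R).submatrix e id, ?_, ?_, ?_⟩
  · rw [Matrix.submatrix_mul_equiv]; simp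
  · rw [← Matrix.submatrix_mul _ _ _ _ _ Function.bijective_id]; simp
  · rw [← Matrix.submatrix_id_id A, ← Matrix.submatrix_mul _ _ _ _ _ Function.bijective_id,
      ← Matrix.submatrix_mul _ _ _ _ _ Function.bijective_id]
    simp

lemma similar_fromBlocks_conj {B : Matrix n n R} {M : Matrix o o R} {P : Matrix n o R}
    {Q : Matrix o n R} (hPQ : P * Q = 1) (hQP : Q * P = 1) (hM : Q * B * P = M)
    {G : Matrix l l' R} {H : Matrix l' l R} (hGH : G * H = 1) (hHG : H * G = 1)
    (Y : Matrix l n R) :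
    MatrixSimilar (fromBlocks B 0 Y 0) (fromBlocks M 0 (H * Y * P) 0) := by
  refine ⟨fromBlocks P 0 0 G, fromBlocks Q 0 0 H, ?_, ?_, ?_⟩ <;>
    simp [fromBlocks_multiply, hPQ, hQP, hGH, hHG, hM]

lemma similar_fromBlocks_add_mul (B : Matrix n n R) (Y : Matrix l n R) (Z : Matrix l n R) :
    MatrixSimilar (fromBlocks B 0 Y 0) (fromBlocks B 0 (Y + Z * B) 0) := by
  refine ⟨fromBlocks 1 0 (-Z) 1, fromBlocks 1 0 Z 1, ?_, ?_, ?_⟩ <;>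
    simp [fromBlocks_multiply, add_comm]

/-- The matrix obtained from `A` by splitting the rows of `Y` off its rows, as prescribed
by `E`, is similar to `A` extended by the rows of `Y` and zero columns. -/
lemma similar_fromBlocks_split (A : Matrix n n R) (Y : Matrix l n R) (E : Matrix n l R) :
    MatrixSimilar (fromBlocks (A - E * Y) ((A - E * Y) * E) Y (Y * E)) (fromBlocks A 0 Y 0) := by
  refine MatrixSimilar.symm ⟨fromBlocks 1 E 0 1, fromBlocks 1 (-E) 0 1, ?_, ?_, ?_⟩ <;>
    simp [fromBlocks_multiply, sub_eq_add_neg]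

lemma similar_fromBlocks_mul_swap (V : Matrix n l R) (X : Matrix l n R) (Z : Matrix l n R)
    (h : X * V * Z = X) :
    MatrixSimilar (fromBlocks (V * X) 0 X 0) (fromBlocks (0 : Matrix n n R) 0 0 (X * V)) := by
  refine MatrixSimilar.trans (B := fromBlocks (0 : Matrix n n R) 0 X (X * V)) ?_ ?_
  · refine ⟨fromBlocks 1 V 0 1, fromBlocks 1 (-V) 0 1, ?_, ?_, ?_⟩ <;>
      simp [fromBlocks_multiply]
  · refine ⟨fromBlocks 1 0 (-Z) 1, fromBlocks 1 0 Z 1, ?_, ?_, ?_⟩ <;>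
      simp [fromBlocks_multiply, h]

lemma similar_fromRows_smul {ε δ k : R} (h : k * ε + δ = 1) (B : Matrix n n R)
    (Y : Matrix m n R) :
    MatrixSimilar (fromBlocks B 0 (fromRows (ε • Y) (δ • Y)) (0 : Matrix (m ⊕ m) (m ⊕ m) R))
      (fromBlocks B 0 (fromRows Y 0) (0 : Matrix (m ⊕ m) (m ⊕ m) R)) := by
  have h1 : ε * k + δ = 1 := by rw [mul_comm, h]
  have h2 : δ + ε * k = 1 := by rw [add_comm, h1]
  have key : fromRows Y (0 : Matrix m n R) =
      (fromBlocks (k • 1) 1 (-δ • 1) (ε • 1) : Matrix (m ⊕ m) (m ⊕ m) R) *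
        fromRows (ε • Y) (δ • Y) * (1 : Matrix n n R) := by
    rw [Matrix.mul_one, fromBlocks_mul_fromRows]
    congr 1
    · simp [smul_smul, ← add_smul, h1]
    · simp [smul_smul, mul_comm]
  rw [key]
  refine similar_fromBlocks_conj (P := 1) (Q := 1) (by simp) (by simp) (by simp)
    (G := fromBlocks (ε • 1) (-1) (δ • 1) (k • 1)) ?_ ?_ _
  · simp [fromBlocks_multiply, smul_smul, ← add_smul, h1, h2, mul_comm]
  · simp [fromBlocks_multiply, smul_smul, ← add_smul, h1, h2, mul_comm]

end Similarity

section Positivity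

variable {U : Subring ℝ} {m n : Type*} [Fintype m] [Fintype n]

lemma exists_pos_add_mul_of_pos [Nonempty n] {A : Matrix n n U} (hA : ∀ i j, 0 < A i j)
    (Y : Matrix m n U) : ∃ Z : Matrix m n U, ∀ i j, 0 < (Y + Z * A) i j := by
  have hev : ∀ᶠ N : ℕ in Filter.atTop, ∀ i j, 0 < (Y i j : ℝ) + N * ∑ x, (A x j : ℝ) := by
    rw [Filter.eventually_all]; intro i
    rw [Filter.eventually_all]; intro j
    have hs : 0 < ∑ x, (A x j : ℝ) :=
      Finset.sum_pos (fun x _ => hA x j) Finset.univ_nonempty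
    exact (Filter.tendsto_atTop_add_const_left _ _
      (tendsto_natCast_atTop_atTop.atTop_mul_const hs)).eventually_gt_atTop 0
  obtain ⟨N, hN⟩ := hev.exists
  refine ⟨of fun _ _ => (N : U), fun i j => ?_⟩
  have := hN i j
  rw [← Subtype.coe_lt_coe]
  simpa [Matrix.mul_apply, Finset.mul_sum] using this

/-- Small positive elements `ε`, `δ` generating the unit ideal of a dense subring. -/
lemma exists_pos_lt_unimodular (hU : Dense (U : Set ℝ)) {η : ℝ} (hη : 0 < η) :
    ∃ ε δ k : U, 0 < ε ∧ 0 < δ ∧ (ε : ℝ) < η ∧ (δ : ℝ) < η ∧ k * ε + δ = 1 := by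
  obtain ⟨ε, hεU, hε, hεη⟩ := hU.exists_between hη
  obtain ⟨a, ⟨ha, ha'⟩, -⟩ := existsUnique_add_zsmul_mem_Ioc hε 1 0
  refine ⟨⟨ε, hεU⟩, 1 + a * ⟨ε, hεU⟩, -a, hε, ?_, hεη, ?_, by ring⟩
  · rw [← Subtype.coe_lt_coe]
    simpa using ha
  · have : 1 + (a : ℝ) * ε ≤ ε := by simpa using ha'
    simpa using this.trans_lt hεη

/-- Modulo similarity, arbitrary additional rows can be replaced by small positive ones. -/
lemma exists_pos_rows_similar [DecidableEq m] [DecidableEq n] (hU : Dense (U : Set ℝ))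
    {A : Matrix n n U}
    (hA : ∀ i j, 0 < A i j) (r : n) (Y : Matrix m n U) :
    ∃ Y' : Matrix (m ⊕ m) n U, (∀ i j, 0 < Y' i j) ∧ (∀ j, ∑ i, Y' i j < A r j) ∧
      MatrixSimilar (fromBlocks A 0 Y' (0 : Matrix (m ⊕ m) (m ⊕ m) U))
        (fromBlocks A 0 (fromRows Y 0) (0 : Matrix (m ⊕ m) (m ⊕ m) U)) := by
  have : Nonempty n := ⟨r⟩
  obtain ⟨Z, hZ⟩ := exists_pos_add_mul_of_pos hA Y
  set T := Y + Z * A with hT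
  have hev : ∀ᶠ x : ℝ in nhdsWithin 0 (Set.Ioi 0), ∀ j,
      x * ∑ i, (T i j : ℝ) + x * ∑ i, (T i j : ℝ) < A r j := by
    rw [Filter.eventually_all]; intro j
    have hc : Filter.Tendsto
        (fun x : ℝ => x * ∑ i, (T i j : ℝ) + x * ∑ i, (T i j : ℝ)) (nhds 0) (nhds 0) := by
      have : Continuous (fun x : ℝ => x * ∑ i, (T i j : ℝ) + x * ∑ i, (T i j : ℝ)) := by
        fun_prop
      simpa using this.tendsto 0
    exact (hc.mono_left nhdsWithin_le_nhds).eventually_lt_const (hA r j)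
  obtain ⟨η, hη', hη⟩ := (hev.and self_mem_nhdsWithin).exists
  obtain ⟨ε, δ, k, hε, hδ, hεη, hδη, hk⟩ := exists_pos_lt_unimodular hU hη
  refine ⟨fromRows (ε • T) (δ • T), ?_, fun j => ?_, ?_⟩
  · rintro (i | i) j
    · exact mul_pos hε (hZ i j)
    · exact mul_pos hδ (hZ i j)
  · have hs : 0 ≤ ∑ i, (T i j : ℝ) := Finset.sum_nonneg fun i _ => (hZ i j).le
    rw [← Subtype.coe_lt_coe]
    have h1 := mul_le_mul_of_nonneg_right hεη.le hs
    have h2 := mul_le_mul_of_nonneg_right hδη.le hs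
    simpa [← Finset.mul_sum] using (add_le_add h1 h2).trans_lt (hη' j)
  · refine (similar_fromRows_smul hk A T).trans ?_
    have h := similar_fromBlocks_add_mul A (fromRows Y (0 : Matrix m n U))
      (fromRows Z (0 : Matrix m n U))
    rw [fromRows_mul] at h
    have h' : fromRows Y (0 : Matrix m n U) + fromRows (Z * A) ((0 : Matrix m n U) * A) =
        fromRows T 0 := by
      ext (i | i) j <;> simp [hT]
    rw [h'] at h
    exact h.symm

end Positivity

lemma exists_map_subtype {U : Subring ℝ} {m n : ℕ} {M : Matrix (Fin m) (Fin n) ℝ}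
    (h : entriesIn (U : Set ℝ) M) : ∃ M' : Matrix (Fin m) (Fin n) U, M'.map U.subtype = M :=
  ⟨of fun i j => ⟨M i j, h i j⟩, by ext; rfl⟩

lemma IsSubdivision.exists_mul_eq_one {U : Subring ℝ} {m n : ℕ} {V : Matrix (Fin m) (Fin n) U}
    (h : IsSubdivision (V.map U.subtype)) : ∃ R : Matrix (Fin n) (Fin m) U, V * R = 1 := by
  obtain ⟨h01, huniq, hsurj⟩ := h
  choose s hs using hsurj
  refine ⟨of fun i j => if i = s j then 1 else 0, ?_⟩
  ext i j
  simp only [Matrix.mul_apply, of_apply, mul_ite, mul_one, mul_zero, Finset.sum_ite_eq',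
    Finset.mem_univ, if_true]
  by_cases hij : i = j
  · subst hij
    simpa using hs i
  · rcases h01 (s j) i with h0 | h1
    · rw [Matrix.one_apply_ne hij]
      simpa using h0
    · exact absurd ((huniq (s j)).unique h1 (hs j)) hij

lemma IsSubdivision.eq_zero {n : ℕ} {V : Matrix (Fin 0) (Fin n) ℝ} (h : IsSubdivision V) :
    n = 0 := by
  by_contra hn
  obtain ⟨j, -⟩ := h.2.1 ⟨0, Nat.pos_of_ne_zero hn⟩
  exact j.elim0

/-- Splitting small positive rows off a single row of a positive matrix is an elementary row
splitting with positive result. -/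
lemma exists_pos_rowSplitting {U : Subring ℝ} {N N' : ℕ} {l : Type*} [Fintype l] [DecidableEq l]
    {A : Matrix (Fin N) (Fin N) U} (hA : ∀ i j, 0 < A i j) (r : Fin N) {Y : Matrix l (Fin N) U}
    (hY : ∀ i j, 0 < Y i j) (hYr : ∀ j, ∑ i, Y i j < A r j) (e : Fin N' ≃ Fin N ⊕ l) :
    ∃ B : Matrix (Fin N') (Fin N') U, (∀ i j, 0 < B i j) ∧
      RowSplitting {x : ℝ | x ∈ U ∧ 0 ≤ x} ⟨N, A.map U.subtype⟩ ⟨N', B.map U.subtype⟩ ∧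
      MatrixSimilar B (fromBlocks A 0 Y 0) := by
  set E : Matrix (Fin N) l U := of fun i _ => if r = i then 1 else 0 with hE
  set f : Fin N ⊕ l → Fin N := Sum.elim id fun _ => r with hf
  set V : Matrix (Fin N) (Fin N ⊕ l) U := fromCols 1 E with hV
  set X : Matrix (Fin N ⊕ l) (Fin N) U := fromRows (A - E * Y) Y with hX
  have hVf : ∀ i x, V i x = if f x = i then 1 else 0 := by
    rintro i (x | x)
    · simp [hV, hf, Matrix.one_apply, eq_comm]
    · simp [hV, hf, hE]
  have hVX : V * X = A := by simp [hV, hX, fromCols_mul_fromRows]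
  have hXV : X * V = fromBlocks (A - E * Y) ((A - E * Y) * E) Y (Y * E) := by
    rw [hX, hV, fromRows_mul_fromCols]
    simp
  have hXpos : ∀ x j, 0 < X x j := by
    rintro (i | i) j
    · have hEY : (E * Y) i j = if r = i then ∑ x, Y x j else 0 := by
        by_cases h : r = i <;> simp [hE, Matrix.mul_apply, h]
      simp only [hX, fromRows_apply_inl, Matrix.sub_apply, hEY]
      split_ifs with h
      · subst h
        exact sub_pos.2 (hYr j)
      · simpa using hA i j
    · exact hY i j
  have hXVpos : ∀ x y, 0 < (X * V) x y := by
    intro x y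
    have : (X * V) x y = X x (f y) := by simp [Matrix.mul_apply, hVf]
    rw [this]
    exact hXpos _ _
  refine ⟨(X * V).submatrix e e, fun i j => hXVpos _ _,
    ⟨(V.submatrix id e).map U.subtype, (X.submatrix e id).map U.subtype, ?_, ?_, ?_, ?_, ?_⟩, ?_⟩
  · refine ⟨fun x i => ?_, fun x => ⟨f (e x), ?_, fun i => ?_⟩, fun i => ⟨e.symm (Sum.inl i), ?_⟩⟩
    · by_cases h : f (e x) = i <;> simp [hVf, h]
    · simp [hVf]
    · by_cases h : f (e x) = i <;> simp [hVf, h]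
    · simp [hVf, hf]
  · intro i x
    refine ⟨(V i (e x)).2, ?_⟩
    by_cases h : f (e x) = i <;> simp [hVf, h]
  · exact fun x j => ⟨(X (e x) j).2, (hXpos (e x) j).le⟩
  · rw [← Matrix.map_mul, Matrix.submatrix_mul_equiv, hVX, Matrix.submatrix_id_id]
  · rw [← Matrix.map_mul, ← Matrix.submatrix_mul _ _ _ _ _ Function.bijective_id]
  · refine (similar_submatrix _ e).symm.trans ?_
    rw [hXV]
    exact similar_fromBlocks_split A Y E

/-- A row splitting over `U` of the nonzero block can be followed, up to similarity, by a
row splitting of a positive matrix. -/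
lemma exists_pos_rowSplitting_similar {U : Subring ℝ} (hU : Dense (U : Set ℝ)) {N k k' q : ℕ}
    (hN : N = k + q) {A : Matrix (Fin N) (Fin N) U} (hA : ∀ i j, 0 < A i j) (r : Fin N)
    {V : Matrix (Fin k) (Fin k') U} {X : Matrix (Fin k') (Fin k) U}
    {R : Matrix (Fin k') (Fin k) U} (hVR : V * R = 1)
    (hAC : MatrixSimilar A (fromBlocks (V * X) 0 0 (0 : Matrix (Fin q) (Fin q) U))) :
    ∃ B : Matrix (Fin (k' + (N + k'))) (Fin (k' + (N + k'))) U, (∀ i j, 0 < B i j) ∧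
      RowSplitting {x : ℝ | x ∈ U ∧ 0 ≤ x} ⟨N, A.map U.subtype⟩ ⟨_, B.map U.subtype⟩ ∧
      MatrixSimilar B (fromBlocks (X * V) 0 0 (0 : Matrix (Fin (N + k')) (Fin (N + k')) U)) := by
  obtain ⟨P, Q, hPQ, hQP, hM⟩ := hAC
  obtain ⟨Y, hY, hYr, hsim⟩ := exists_pos_rows_similar hU hA r
    (fromCols X (0 : Matrix (Fin k') (Fin q) U) * Q)
  have e : Fin (k' + (N + k')) ≃ Fin N ⊕ (Fin k' ⊕ Fin k') :=
    Fintype.equivOfCardEq (by simp; ring)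
  obtain ⟨B, hB, hsplit, hBsim⟩ := exists_pos_rowSplitting hA r hY hYr e
  refine ⟨B, hB, hsplit, hBsim.trans (hsim.trans ?_)⟩
  have h := similar_fromBlocks_conj hPQ hQP hM (Matrix.one_mul 1) (Matrix.one_mul 1)
    (fromRows (fromCols X (0 : Matrix (Fin k') (Fin q) U) * Q) (0 : Matrix (Fin k') (Fin N) U))
  have hX : (1 : Matrix (Fin k' ⊕ Fin k') (Fin k' ⊕ Fin k') U) *
      fromRows (fromCols X (0 : Matrix (Fin k') (Fin q) U) * Q) (0 : Matrix (Fin k') (Fin N) U)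
        * P = fromBlocks X 0 0 0 := by
    rw [Matrix.one_mul, fromRows_mul, Matrix.mul_assoc, hQP, Matrix.mul_one, Matrix.zero_mul]
    ext (i | i) (j | j) <;> simp
  rw [hX] at h
  refine h.trans ?_
  let V' : Matrix (Fin k ⊕ Fin q) (Fin k' ⊕ Fin k') U := fromBlocks V 0 0 0
  let X' : Matrix (Fin k' ⊕ Fin k') (Fin k ⊕ Fin q) U := fromBlocks X 0 0 0
  have hswap := similar_fromBlocks_mul_swap V' X' (fromBlocks R 0 0 0)
    (by simp [V', X', fromBlocks_multiply, Matrix.mul_assoc, hVR])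
  have hVX : V' * X' = fromBlocks (V * X) 0 0 0 := by simp [V', X', fromBlocks_multiply]
  have hXV : X' * V' = fromBlocks (X * V) 0 0 0 := by simp [V', X', fromBlocks_multiply]
  rw [hVX, hXV] at hswap
  refine hswap.trans ?_
  have e₀ : Fin (N + k') ≃ (Fin k ⊕ Fin q) ⊕ Fin k' := Fintype.equivOfCardEq (by simp [hN])
  let e' : Fin k' ⊕ Fin (N + k') ≃ (Fin k ⊕ Fin q) ⊕ (Fin k' ⊕ Fin k') :=
    (Equiv.sumCongr (Equiv.refl _) e₀).trans ((Equiv.sumComm _ _).trans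
      ((Equiv.sumAssoc _ _ _).trans (Equiv.sumCongr (Equiv.refl _) (Equiv.sumComm _ _))))
  have hl (i : Fin k') : e' (Sum.inl i) = Sum.inr (Sum.inl i) := rfl
  have hr (x : Fin (N + k')) : (∃ y, e' (Sum.inr x) = Sum.inl y) ∨
      ∃ y, e' (Sum.inr x) = Sum.inr (Sum.inr y) := by
    rcases h : e₀ x with y | y
    · exact Or.inl ⟨y, by simp [e', h]⟩
    · exact Or.inr ⟨y, by simp [e', h]⟩
  convert similar_submatrix _ e' using 1
  ext (i | i) (j | j)
  · simp [hl]
  · rcases hr j with ⟨y, hy⟩ | ⟨y, hy⟩ <;> simp [hl, hy]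
  · rcases hr i with ⟨y, hy⟩ | ⟨y, hy⟩ <;> simp [hl, hy]
  · rcases hr i with ⟨y, hy⟩ | ⟨y, hy⟩ <;> rcases hr j with ⟨z, hz⟩ | ⟨z, hz⟩ <;> simp [hy, hz]

/-- Every finite sequence of row splittings over `U` is followed, up to similarity and zero
blocks, by a sequence of row splittings of positive matrices. -/
lemma exists_pos_chain_similar {U : Subring ℝ} (hU : Dense (U : Set ℝ)) {n : ℕ}
    {A C : Matrix (Fin n) (Fin n) U} (hA : ∀ i j, 0 < A i j) (hAC : MatrixSimilar A C)
    {p : (n : ℕ) × Matrix (Fin n) (Fin n) ℝ}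
    (h : Relation.ReflTransGen (RowSplitting (U : Set ℝ)) ⟨n, C.map U.subtype⟩ p) :
    ∃ D : Matrix (Fin p.1) (Fin p.1) U, D.map U.subtype = p.2 ∧
      ∃ (q N : ℕ) (B : Matrix (Fin N) (Fin N) U), N = p.1 + q ∧ (∀ i j, 0 < B i j) ∧
        Relation.ReflTransGen
          (fun p q' => PosEntries p.2 ∧ PosEntries q'.2 ∧
            RowSplitting {x : ℝ | x ∈ U ∧ 0 ≤ x} p q')
          ⟨n, A.map U.subtype⟩ ⟨N, B.map U.subtype⟩ ∧
        MatrixSimilar B (fromBlocks D 0 0 (0 : Matrix (Fin q) (Fin q) U)) := by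
  induction h with
  | refl =>
    refine ⟨C, rfl, 0, n, A, rfl, hA, .refl, hAC.trans ?_⟩
    convert similar_submatrix C (Equiv.sumEmpty (Fin n) (Fin 0)) using 1
    ext (i | i) (j | j)
    · rfl
    · exact j.elim0
    · exact i.elim0
    · exact i.elim0
  | @tail p p' _ hstep ih =>
    obtain ⟨D, hD, q, N, B, hN, hB, hchain, hsim⟩ := ih
    obtain ⟨V₀, X₀, hsub, hV₀, hX₀, hpV, hpX⟩ := hstep
    obtain ⟨V, rfl⟩ := exists_map_subtype hV₀
    obtain ⟨X, rfl⟩ := exists_map_subtype hX₀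
    obtain ⟨R, hVR⟩ := hsub.exists_mul_eq_one
    have hDV : D = V * X := by
      apply Matrix.map_injective U.subtype_injective
      simp only [hD, hpV, Matrix.map_mul]
    subst hDV
    refine ⟨X * V, by rw [hpX, Matrix.map_mul], ?_⟩
    rcases Nat.eq_zero_or_pos N with h0 | hpos
    · obtain ⟨k, M⟩ := p
      obtain ⟨k', M'⟩ := p'
      obtain rfl : k = 0 := by simp only at hN; omega
      obtain rfl : k' = 0 := hsub.eq_zero
      subst h0
      exact ⟨0, 0, B, rfl, hB, hchain, 0, 0, by ext i; exact i.elim0,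
        by ext i; exact isEmptyElim i, by ext i; exact isEmptyElim i⟩
    · obtain ⟨B', hB', hsplit, hsim'⟩ :=
        exists_pos_rowSplitting_similar hU hN hB ⟨0, hpos⟩ hVR hsim
      exact ⟨_, _, B', rfl, hB', hchain.tail ⟨fun i j => hB i j, fun i j => hB' i j, hsplit⟩,
        hsim'⟩

/-- Splitting Lemma, part (2): if `A` is positive and conjugate over `U` to `C`, and `C'`
is obtained from `C` by a finite sequence of elementary row splittings over `U`, then there
is a positive matrix `A⁺` obtained from `A` by a finite sequence of row splittings over `U₊`
through positive matrices, with `A⁺` conjugate over `U` to `C' ⊕ 0`. -/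
theorem splitting_lemma (U : Subring ℝ) (hU : Dense (U : Set ℝ))
    {n k : ℕ} (A C : Matrix (Fin n) (Fin n) ℝ) (C' : Matrix (Fin k) (Fin k) ℝ)
    (hAU : entriesIn (U : Set ℝ) A) (hCU : entriesIn (U : Set ℝ) C)
    (W Winv : Matrix (Fin n) (Fin n) ℝ)
    (hWU : entriesIn (U : Set ℝ) W) (hWinvU : entriesIn (U : Set ℝ) Winv)
    (hWW : W * Winv = 1) (hWW' : Winv * W = 1) (hconj : Winv * A * W = C)
    (hsplit : Relation.ReflTransGen (RowSplitting (U : Set ℝ)) ⟨n, C⟩ ⟨k, C'⟩)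
    (hApos : PosEntries A) :
    ∃ (q : ℕ) (Aplus : Matrix (Fin (k + q)) (Fin (k + q)) ℝ),
      PosEntries Aplus ∧ entriesIn (U : Set ℝ) Aplus ∧
      Relation.ReflTransGen
        (fun p q' => PosEntries p.2 ∧ PosEntries q'.2 ∧
          RowSplitting {x : ℝ | x ∈ U ∧ 0 ≤ x} p q')
        ⟨n, A⟩ ⟨k + q, Aplus⟩ ∧
      ConjOver (U : Set ℝ) Aplus
        (Matrix.reindex finSumFinEquiv finSumFinEquiv
          (Matrix.fromBlocks C' 0 0 (0 : Matrix (Fin q) (Fin q) ℝ))) := by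
  obtain ⟨A, rfl⟩ := exists_map_subtype hAU
  obtain ⟨C, rfl⟩ := exists_map_subtype hCU
  obtain ⟨W, rfl⟩ := exists_map_subtype hWU
  obtain ⟨Winv, rfl⟩ := exists_map_subtype hWinvU
  have hinj {m : ℕ} : Function.Injective
      fun M : Matrix (Fin m) (Fin m) U => M.map U.subtype :=
    Matrix.map_injective U.subtype_injective
  have hone {m : ℕ} : (1 : Matrix (Fin m) (Fin m) U).map U.subtype = 1 :=
    Matrix.map_one _ rfl rfl
  have hAC : MatrixSimilar A C := by
    refine ⟨W, Winv, hinj ?_, hinj ?_, hinj ?_⟩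
    · simp only [Matrix.map_mul, hone, hWW]
    · simp only [Matrix.map_mul, hone, hWW']
    · simp only [Matrix.map_mul, hconj]
  obtain ⟨D, hD, q, N, B, hN, hB, hchain, hsim⟩ :=
    exists_pos_chain_similar hU (fun i j => hApos i j) hAC hsplit
  simp only at D hD hN hsim
  subst hD hN
  refine ⟨q, B.map U.subtype, fun i j => hB i j, fun i j => (B i j).2, hchain, ?_⟩
  obtain ⟨P, Q, hPQ, hQP, hBD⟩ := hsim.trans
    (similar_submatrix (fromBlocks D 0 0 (0 : Matrix (Fin q) (Fin q) U)) finSumFinEquiv.symm)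
  refine ⟨P.map U.subtype, Q.map U.subtype, fun i j => (P i j).2, fun i j => (Q i j).2, ?_, ?_, ?_⟩
  · rw [← Matrix.map_mul, hPQ, hone]
  · rw [← Matrix.map_mul, hQP, hone]
  · rw [← Matrix.map_mul, ← Matrix.map_mul, hBD, ← Matrix.submatrix_map, Matrix.fromBlocks_map]
    simp [Matrix.reindex_apply]
end

section
/- Let A be an n×n real matrix. Then the number of connected components of Cent_ℝ(A) equals 2^{γ(A)}, where γ(A) is the number of pairs (λ, j) with λ ∈ ℝ and 1 ≤ j ≤ n such that rank((A−λI)^{j−1}) + rank((A−λI)^{j+1}) > 2·rank((A−λI)^{j}). -/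
open Matrix

/-- The centralizer of `A` in `GL(n,ℝ)`, as a subspace of the space of matrices. -/
def CentR {n : ℕ} (A : Matrix (Fin n) (Fin n) ℝ) : Set (Matrix (Fin n) (Fin n) ℝ) :=
  {B | IsUnit B ∧ A * B = B * A}

/-- `γ(A)`: the number of pairs `(λ, j)`, `λ ∈ ℝ`, `1 ≤ j ≤ n`, such that the real
Jordan form of `A` contains a `j × j` Jordan block with eigenvalue `λ`, detected by
the rank condition `rank((A-λI)^(j-1)) + rank((A-λI)^(j+1)) > 2 rank((A-λI)^j)`. -/
noncomputable def gammaOf {n : ℕ} (A : Matrix (Fin n) (Fin n) ℝ) : ℕ :=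
  Set.ncard {p : ℝ × ℕ | 1 ≤ p.2 ∧ p.2 ≤ n ∧
    2 * ((A - p.1 • 1) ^ p.2).rank <
      ((A - p.1 • 1) ^ (p.2 - 1)).rank + ((A - p.1 • 1) ^ (p.2 + 1)).rank}

section Idempotents

variable {n : ℕ} {E F M : Matrix (Fin n) (Fin n) ℝ}

theorem det_one_sub_two_mul_of_idempotent (hE : E * E = E) :
    (1 - 2 * E).det = (-1) ^ E.rank := by
  have hg : IsIdempotentElem (Matrix.toLin' E) := by
    rw [IsIdempotentElem, Module.End.mul_eq_comp, ← Matrix.toLin'_mul, hE]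
  have hp := LinearMap.IsIdempotentElem.isProj_range _ hg
  set e := (LinearMap.range (toLin' E)).prodEquivOfIsCompl _ hp.isCompl with he
  have h1 : toLin' (1 - 2 * E) = e.conj (LinearMap.prodMap (-LinearMap.id) LinearMap.id) := by
    have h2 : toLin' (1 - 2 * E) = LinearMap.id - (2 : ℝ) • toLin' E := by
      rw [two_mul, map_sub, toLin'_one, map_add, two_smul]
    have h3 : (LinearMap.prodMap (-LinearMap.id) LinearMap.id :
        (LinearMap.range (toLin' E) × LinearMap.ker (toLin' E)) →ₗ[ℝ] _) =
        LinearMap.id - (2 : ℝ) • LinearMap.prodMap LinearMap.id 0 := by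
      ext <;> simp [two_smul]
    have h4 : toLin' E = e.conj (LinearMap.prodMap LinearMap.id 0) := hp.eq_conj_prodMap
    rw [h2, h3]
    refine LinearMap.ext fun x => ?_
    have h5 := LinearMap.congr_fun h4 x
    rw [LinearEquiv.conj_apply_apply] at h5 ⊢
    rw [LinearMap.sub_apply, LinearMap.sub_apply, LinearMap.smul_apply, LinearMap.smul_apply,
      map_sub, map_smul, h5, LinearMap.id_apply, LinearMap.id_apply, e.apply_symm_apply]
  rw [← LinearMap.det_toLin', h1, LinearEquiv.conj_apply, LinearMap.comp_assoc]
  have := LinearMap.det_conj (LinearMap.prodMap (-LinearMap.id) LinearMap.id :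
        (LinearMap.range (toLin' E) × LinearMap.ker (toLin' E)) →ₗ[ℝ] _) e
  rw [LinearMap.det_prodMap] at this
  simp only [LinearMap.det_id, mul_one] at this
  have hneg : (-LinearMap.id : Module.End ℝ (LinearMap.range (toLin' E))) =
      (-1 : ℝ) • LinearMap.id :=
    LinearMap.ext fun x => (neg_one_smul ℝ x).symm
  rw [this, hneg, LinearMap.det_smul, LinearMap.det_id, mul_one]
  rfl

theorem rank_add_mul_of_orthogonal (hE : E * E = E) (hF : F * F = F) (hEF : E * F = 0)
    (hFE : F * E = 0) (hEM : E * M = M * E) (hFM : F * M = M * F) :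
    ((E + F) * M).rank = (E * M).rank + (F * M).rank := by
  have hsup : LinearMap.range ((E + F) * M).mulVecLin =
      LinearMap.range (E * M).mulVecLin ⊔ LinearMap.range (F * M).mulVecLin := by
    apply le_antisymm
    · rintro _ ⟨x, rfl⟩
      rw [add_mul, mulVecLin_add, LinearMap.add_apply]
      exact Submodule.add_mem_sup ⟨x, rfl⟩ ⟨x, rfl⟩
    · refine sup_le ?_ ?_
      · rintro _ ⟨x, rfl⟩
        refine ⟨E *ᵥ x, ?_⟩
        rw [mulVecLin_apply, mulVecLin_apply, mulVec_mulVec]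
        congr 1
        rw [mul_assoc, ← hEM, ← mul_assoc, add_mul, hE, hFE, add_zero]
      · rintro _ ⟨x, rfl⟩
        refine ⟨F *ᵥ x, ?_⟩
        rw [mulVecLin_apply, mulVecLin_apply, mulVec_mulVec]
        congr 1
        rw [mul_assoc, ← hFM, ← mul_assoc, add_mul, hF, hEF, zero_add]
  have hinf : LinearMap.range (E * M).mulVecLin ⊓ LinearMap.range (F * M).mulVecLin = ⊥ := by
    rw [eq_bot_iff]
    rintro y ⟨⟨a, ha⟩, ⟨b, hb⟩⟩
    rw [mulVecLin_apply] at ha hb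
    have h1 : E *ᵥ y = y := by
      rw [← ha, mulVec_mulVec, ← mul_assoc, hE]
    have h2 : E *ᵥ y = 0 := by
      rw [← hb, mulVec_mulVec, ← mul_assoc, hEF, zero_mul, zero_mulVec]
    simpa [h1] using h2
  have := Submodule.finrank_sup_add_finrank_inf_eq (LinearMap.range (E * M).mulVecLin)
    (LinearMap.range (F * M).mulVecLin)
  rw [hinf, finrank_bot, add_zero, ← hsup] at this
  exact this

theorem exists_mul_mul_eq_self (M : Matrix (Fin n) (Fin n) ℝ) :
    ∃ Y : Matrix (Fin n) (Fin n) ℝ, M * Y * M = M := by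
  obtain ⟨g, hg⟩ := (toLin' M).rangeRestrict.exists_rightInverse_of_surjective
    (LinearMap.range_rangeRestrict _)
  obtain ⟨h, hh⟩ := LinearMap.exists_extend g
  refine ⟨LinearMap.toMatrix' h, ?_⟩
  apply toLin'.injective
  rw [toLin'_mul, toLin'_mul, toLin'_toMatrix']
  refine LinearMap.ext fun x => ?_
  have h1 : h (toLin' M x) = g ((toLin' M).rangeRestrict x) :=
    LinearMap.congr_fun hh ((toLin' M).rangeRestrict x)
  have h2 := congrArg Subtype.val (LinearMap.congr_fun hg ((toLin' M).rangeRestrict x))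
  rw [LinearMap.comp_apply, LinearMap.comp_apply, h1]
  exact h2

/-- A continuous version of the determinant of a matrix commuting with `M`, restricted to the
range of `M`. -/
theorem exists_det_on_range (M : Matrix (Fin n) (Fin n) ℝ) :
    ∃ D : Matrix (Fin n) (Fin n) ℝ → ℝ, Continuous D ∧ D 1 = 1 ∧
      (∀ B C, B * M = M * B → C * M = M * C → D (B * C) = D B * D C) ∧
      ∀ E, E * E = E → E * M = M * E → D (1 - 2 * E) = (-1) ^ (E * M).rank := by
  obtain ⟨Y, hY⟩ := exists_mul_mul_eq_self M
  have hQ : M * Y * (M * Y) = M * Y := by rw [← mul_assoc, hY]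
  have key : ∀ B, B * M = M * B → M * Y * B * (M * Y) = B * (M * Y) := fun B hB => by
    calc M * Y * B * (M * Y) = M * Y * (B * M) * Y := by noncomm_ring
      _ = M * Y * M * B * Y := by rw [hB]; noncomm_ring
      _ = B * (M * Y) := by rw [hY, ← hB, mul_assoc]
  refine ⟨fun B => (B * (M * Y) + (1 - M * Y)).det, by fun_prop, by simp, ?_, ?_⟩
  · intro B C hB hC
    simp only
    rw [← det_mul]
    congr 1
    set Q := M * Y
    have h1 : Q * C * Q = C * Q := key C hC
    calc B * C * Q + (1 - Q) = B * (C * Q) + (1 - Q) := by rw [mul_assoc]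
      _ = B * (Q * C * Q) + (B * Q - B * (Q * Q)) + (C * Q - Q * C * Q) +
          (1 - Q - Q + Q * Q) := by rw [hQ, h1]; noncomm_ring
      _ = _ := by noncomm_ring
  · intro E hE hEM
    have hEQ := key E hEM
    set Q := M * Y with hQdef
    have h2 : (1 - 2 * E) * Q + (1 - Q) = 1 - 2 * (E * Q) := by noncomm_ring
    have h3 : E * Q * (E * Q) = E * Q := by
      rw [mul_assoc, ← mul_assoc Q, hEQ, ← mul_assoc, hE]
    simp only [h2]
    rw [det_one_sub_two_mul_of_idempotent h3]
    congr 1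
    apply le_antisymm
    · rw [hQdef, ← mul_assoc]
      exact rank_mul_le_left _ _
    · conv_lhs => rw [← hY, ← mul_assoc]
      exact rank_mul_le_left _ _

end Idempotents

section JordanBlocks

/-- The nilpotent `j × j` Jordan block, with ones below the diagonal. -/
def shiftMatrix (j : ℕ) : Matrix (Fin j) (Fin j) ℝ :=
  of fun a b => if (a : ℕ) = b + 1 then 1 else 0

theorem shiftMatrix_apply (j : ℕ) (a b : Fin j) :
    shiftMatrix j a b = if (a : ℕ) = b + 1 then 1 else 0 := rfl

theorem shiftMatrix_pow_apply (j k : ℕ) (a b : Fin j) :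
    (shiftMatrix j ^ k) a b = if (a : ℕ) = b + k then 1 else 0 := by
  induction k generalizing a b with
  | zero => simp [one_apply, Fin.ext_iff]
  | succ k ih =>
    rw [pow_succ, mul_apply]
    simp only [ih, shiftMatrix_apply]
    by_cases h : (b : ℕ) + 1 < j
    · rw [Finset.sum_eq_single ⟨b + 1, h⟩]
      · simp only [if_true, mul_one]
        congr 1
        rw [add_right_comm, add_assoc]
      · intro c _ hc
        rw [if_neg (c := (c : ℕ) = b + 1)]
        · simp
        · intro h'
          exact hc (Fin.ext h')
      · simp
    · rw [Finset.sum_eq_zero, if_neg (by omega)]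
      intro c _
      rw [if_neg (c := (c : ℕ) = b + 1) (by omega), mul_zero]

theorem rank_shiftMatrix_pow (j k : ℕ) : (shiftMatrix j ^ k).rank = j - k := by
  have h : shiftMatrix j ^ k * (shiftMatrix j ^ k)ᵀ =
      diagonal fun a : Fin j => if k ≤ (a : ℕ) then (1 : ℝ) else 0 := by
    ext a b
    rw [mul_apply]
    simp only [transpose_apply, shiftMatrix_pow_apply, diagonal_apply]
    by_cases hk : k ≤ (a : ℕ)
    · rw [Finset.sum_eq_single ⟨a - k, by omega⟩]
      · simp only [Nat.sub_add_cancel hk, if_true, if_pos hk, one_mul, Fin.ext_iff]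
        congr 1
        grind
      · intro c _ hc
        rw [if_neg (c := (a : ℕ) = c + k), zero_mul]
        intro h'
        exact hc (Fin.ext (by simp; omega))
      · simp
    · rw [Finset.sum_eq_zero]
      · simp [hk]
      · intro c _
        rw [if_neg (c := (a : ℕ) = c + k) (by omega), zero_mul]
  rw [← rank_self_mul_transpose, h, rank_diagonal]
  simp only [ne_eq, ite_eq_right_iff, one_ne_zero, imp_false, not_not]
  rw [Fintype.card_subtype]
  rcases le_or_gt j k with hjk | hjk
  · rw [Nat.sub_eq_zero_of_le hjk, Finset.card_eq_zero, Finset.filter_eq_empty_iff]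
    intro a _
    omega
  · have : (Finset.univ.filter fun a : Fin j => k ≤ (a : ℕ)) = Finset.Ici ⟨k, hjk⟩ := by
      ext a
      simp [Fin.le_def]
    rw [this, Fin.card_Ici]

theorem isUnit_shiftMatrix_add_smul (j : ℕ) {c : ℝ} (hc : c ≠ 0) :
    IsUnit (shiftMatrix j + c • (1 : Matrix (Fin j) (Fin j) ℝ)) := by
  rw [isUnit_iff_isUnit_det, det_of_isLowerTriangular, isUnit_iff_ne_zero, Finset.prod_ne_zero_iff]
  · intro i _
    simp [shiftMatrix, hc]
  · intro a b hab
    have : a < b := hab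
    simp [shiftMatrix, one_apply, this.ne]
    omega

variable {n j : ℕ} {A E N : Matrix (Fin n) (Fin n) ℝ}

/-- `P` and `Q` exhibit a `j × j` Jordan block of eigenvalue `l` as a direct summand of `A`,
with associated projection `P * Q`. -/
structure IsJordanSummand (A : Matrix (Fin n) (Fin n) ℝ) (l : ℝ) (P : Matrix (Fin n) (Fin j) ℝ)
    (Q : Matrix (Fin j) (Fin n) ℝ) : Prop where
  mul_eq_one : Q * P = 1
  mul_left : (A - l • 1) * P = P * shiftMatrix j
  mul_right : Q * (A - l • 1) = shiftMatrix j * Q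

namespace IsJordanSummand

variable {l : ℝ} {P : Matrix (Fin n) (Fin j) ℝ} {Q : Matrix (Fin j) (Fin n) ℝ}
  {P' : Matrix (Fin n) (Fin j) ℝ} {Q' : Matrix (Fin j) (Fin n) ℝ}

theorem mul_mul_mul (h : IsJordanSummand A l P Q) : P * Q * (P * Q) = P * Q := by
  rw [Matrix.mul_assoc, ← Matrix.mul_assoc Q, h.mul_eq_one, Matrix.one_mul]

theorem commute_mul (h : IsJordanSummand A l P Q) (h' : IsJordanSummand A l P' Q') :
    A * (P * Q') = P * Q' * A := by
  have h1 : (A - l • 1) * (P * Q') = P * Q' * (A - l • 1) := by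
    rw [← Matrix.mul_assoc, h.mul_left, Matrix.mul_assoc, ← h'.mul_right, Matrix.mul_assoc]
  rw [sub_mul, mul_sub] at h1
  simpa using h1

theorem mul_pow (h : IsJordanSummand A l P Q) (m : ℝ) (k : ℕ) :
    Q * (A - m • 1) ^ k = (shiftMatrix j + (l - m) • 1) ^ k * Q := by
  have h1 : Q * (A - m • 1) = (shiftMatrix j + (l - m) • 1) * Q := by
    rw [Matrix.add_mul, ← h.mul_right, sub_smul, Matrix.sub_mul, Matrix.mul_sub,
      Matrix.mul_sub]
    simp
  induction k with
  | zero => simp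
  | succ k ih =>
    rw [pow_succ, ← Matrix.mul_assoc, ih, Matrix.mul_assoc, h1, ← Matrix.mul_assoc, ← pow_succ]

theorem rank_mul_pow (h : IsJordanSummand A l P Q) (m : ℝ) (k : ℕ) :
    (P * Q * (A - m • 1) ^ k).rank =
      ((shiftMatrix j + (l - m) • (1 : Matrix (Fin j) (Fin j) ℝ)) ^ k).rank := by
  rw [Matrix.mul_assoc, h.mul_pow]
  set T := (shiftMatrix j + (l - m) • (1 : Matrix (Fin j) (Fin j) ℝ)) ^ k
  apply le_antisymm
  · exact (rank_mul_le_right _ _).trans (rank_mul_le_left _ _)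
  · have : T = Q * (P * (T * Q)) * P := by
      rw [← Matrix.mul_assoc, h.mul_eq_one, Matrix.one_mul, Matrix.mul_assoc, h.mul_eq_one,
        Matrix.mul_one]
    conv_lhs => rw [this]
    exact (rank_mul_le_left _ _).trans (rank_mul_le_right _ _)

theorem rank_mul_pow_self (h : IsJordanSummand A l P Q) (k : ℕ) :
    (P * Q * (A - l • 1) ^ k).rank = j - k := by
  rw [h.rank_mul_pow, sub_self, zero_smul, add_zero, rank_shiftMatrix_pow]

theorem rank_mul_pow_of_ne (h : IsJordanSummand A l P Q) {m : ℝ} (hm : m ≠ l) (k : ℕ) :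
    (P * Q * (A - m • 1) ^ k).rank = j := by
  rw [h.rank_mul_pow, rank_of_isUnit, Fintype.card_fin]
  exact (isUnit_shiftMatrix_add_smul j (sub_ne_zero.mpr hm.symm)).pow k

theorem le_card (h : IsJordanSummand A l P Q) : j ≤ n := by
  have := h.rank_mul_pow_self 0
  rw [Nat.sub_zero] at this
  rw [← this]
  exact rank_le_height _

end IsJordanSummand

theorem isUnit_of_mulVec_eq_zero {M : Matrix (Fin n) (Fin n) ℝ}
    (h : ∀ v, M *ᵥ v = 0 → v = 0) : IsUnit M := by
  rw [← mulVec_injective_iff_isUnit]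
  exact (injective_iff_map_eq_zero M.mulVecLin).mpr h

end JordanBlocks

section JordanExistence

variable {n j : ℕ} {A E N : Matrix (Fin n) (Fin n) ℝ}

theorem finrank_map_add_finrank_inf_ker {V : Type*} [AddCommGroup V] [Module ℝ V]
    [FiniteDimensional ℝ V] (L : V →ₗ[ℝ] V) (W : Submodule ℝ V) :
    Module.finrank ℝ (W.map L) + Module.finrank ℝ (W ⊓ LinearMap.ker L : Submodule ℝ V) =
      Module.finrank ℝ W := by
  rw [← LinearMap.finrank_range_add_finrank_ker (L.domRestrict W), LinearMap.range_domRestrict,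
    LinearMap.ker_domRestrict, ← Submodule.map_comap_subtype, Submodule.finrank_map_subtype_eq]

theorem rank_mul_pow_succ_add (hEN : E * N = N * E) (k : ℕ) :
    (E * N ^ (k + 1)).rank + Module.finrank ℝ (LinearMap.range (E * N ^ k).mulVecLin ⊓
      LinearMap.ker N.mulVecLin : Submodule ℝ (Fin n → ℝ)) = (E * N ^ k).rank := by
  have h : LinearMap.range (E * N ^ (k + 1)).mulVecLin =
      (LinearMap.range (E * N ^ k).mulVecLin).map N.mulVecLin := by
    rw [← LinearMap.range_comp, ← mulVecLin_mul, ← mul_assoc, ← hEN, mul_assoc, ← pow_succ']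
  have := finrank_map_add_finrank_inf_ker N.mulVecLin (LinearMap.range (E * N ^ k).mulVecLin)
  rwa [← h] at this

theorem range_mul_pow_succ_le (k : ℕ) :
    LinearMap.range (E * N ^ (k + 1)).mulVecLin ≤ LinearMap.range (E * N ^ k).mulVecLin := by
  rw [pow_succ, ← mul_assoc, mulVecLin_mul]
  exact LinearMap.range_comp_le_range _ _

theorem two_mul_rank_mul_pow_le (hEN : E * N = N * E) (k : ℕ) :
    2 * (E * N ^ (k + 1)).rank ≤ (E * N ^ k).rank + (E * N ^ (k + 2)).rank := by
  have h1 := rank_mul_pow_succ_add hEN k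
  have h2 := rank_mul_pow_succ_add hEN (k + 1)
  have h3 := Submodule.finrank_mono (inf_le_inf_right (LinearMap.ker N.mulVecLin)
    (range_mul_pow_succ_le (E := E) (N := N) k))
  rw [add_assoc, one_add_one_eq_two] at h2
  omega

theorem exists_rank_lt_of_eigenvector (hEN : E * N = N * E) {w : Fin n → ℝ} (hw : w ≠ 0)
    (hEw : E *ᵥ w = w) (hNw : N *ᵥ w = 0) :
    ∃ k, 2 * (E * N ^ (k + 1)).rank < (E * N ^ k).rank + (E * N ^ (k + 2)).rank := by
  by_contra! hcon
  have h0 : (E * N ^ 1).rank + 1 ≤ (E * N ^ 0).rank := by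
    rw [← rank_mul_pow_succ_add hEN 0, zero_add, add_le_add_iff_left, Nat.one_le_iff_ne_zero,
      ne_eq, Submodule.finrank_eq_zero]
    intro hbot
    refine hw ((Submodule.eq_bot_iff _).1 hbot w ⟨⟨w, ?_⟩, hNw⟩)
    simpa using hEw
  have h1 : ∀ k, (E * N ^ (k + 1)).rank + 1 ≤ (E * N ^ k).rank := fun k => by
    induction k with
    | zero => exact h0
    | succ k ih =>
      have := hcon k
      rw [add_assoc, one_add_one_eq_two]
      omega
  have h2 : ∀ k, (E * N ^ k).rank + k ≤ (E * N ^ 0).rank := fun k => by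
    induction k with
    | zero => simp
    | succ k ih =>
      have := h1 k
      omega
  have := h2 ((E * N ^ 0).rank + 1)
  omega

theorem exists_chain_of_rank_lt (hE : E * E = E) (hEN : E * N = N * E) {k : ℕ}
    (h : 2 * (E * N ^ (k + 1)).rank < (E * N ^ k).rank + (E * N ^ (k + 2)).rank) :
    ∃ v r : Fin n → ℝ, E *ᵥ v = v ∧ r ᵥ* E = r ∧ N ^ (k + 1) *ᵥ v = 0 ∧ r ᵥ* N ^ (k + 1) = 0 ∧
      r ⬝ᵥ N ^ k *ᵥ v = 1 := by
  have hENk : ∀ m, E * N ^ m = N ^ m * E := fun m => (Commute.pow_right hEN m :)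
  have h1 := rank_mul_pow_succ_add hEN k
  have h2 := rank_mul_pow_succ_add hEN (k + 1)
  rw [add_assoc, one_add_one_eq_two] at h2
  have h3 : ¬ (LinearMap.range (E * N ^ k).mulVecLin ⊓ LinearMap.ker N.mulVecLin ≤
      LinearMap.range (E * N ^ (k + 1)).mulVecLin ⊓ LinearMap.ker N.mulVecLin) := fun hle => by
    have := Submodule.finrank_mono hle
    omega
  obtain ⟨u, ⟨⟨x, hx⟩, hNu⟩, hu⟩ := SetLike.not_le_iff_exists.1 h3
  replace hNu : N *ᵥ u = 0 := hNu
  rw [mulVecLin_apply] at hx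
  have hu' : u ∉ LinearMap.range (E * N ^ (k + 1)).mulVecLin := fun h' => hu ⟨h', hNu⟩
  obtain ⟨f, hfu, hf⟩ := Submodule.exists_le_ker_of_notMem hu'
  have hr : ∀ y, (fun b => (f u)⁻¹ * f (E *ᵥ Pi.single b 1)) ⬝ᵥ y = (f u)⁻¹ * f (E *ᵥ y) := by
    intro y
    have hy : E *ᵥ y = ∑ b, y b • E *ᵥ Pi.single b 1 := by
      conv_lhs => rw [pi_eq_sum_univ' y]
      rw [mulVec_sum]
      simp [mulVec_smul]
    rw [hy, map_sum, Finset.mul_sum, dotProduct]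
    refine Finset.sum_congr rfl fun b _ => ?_
    rw [map_smul, smul_eq_mul]
    ring
  set r : Fin n → ℝ := fun b => (f u)⁻¹ * f (E *ᵥ Pi.single b 1)
  have hEv : N ^ k *ᵥ (E *ᵥ x) = u := by rw [mulVec_mulVec, ← hENk, hx]
  refine ⟨E *ᵥ x, r, by rw [mulVec_mulVec, hE], ?_, ?_, ?_, ?_⟩
  · refine dotProduct_eq _ _ fun y => ?_
    rw [← dotProduct_mulVec, hr, hr, mulVec_mulVec, hE]
  · rw [pow_succ', ← mulVec_mulVec, hEv, hNu]
  · refine dotProduct_eq _ _ fun y => ?_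
    rw [← dotProduct_mulVec, hr, mulVec_mulVec, zero_dotProduct]
    have : f ((E * N ^ (k + 1)) *ᵥ y) = 0 := hf ⟨y, rfl⟩
    rw [this, mul_zero]
  · rw [hr, hEv, ← hx, mulVec_mulVec, ← mul_assoc, hE, hx, inv_mul_cancel₀ hfu]

theorem exists_isJordanSummand {l : ℝ} (hE : E * E = E) (hEA : E * A = A * E) {k : ℕ}
    (h : 2 * (E * (A - l • 1) ^ (k + 1)).rank <
      (E * (A - l • 1) ^ k).rank + (E * (A - l • 1) ^ (k + 2)).rank) :
    ∃ (P : Matrix (Fin n) (Fin (k + 1)) ℝ) (Q : Matrix (Fin (k + 1)) (Fin n) ℝ),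
      IsJordanSummand A l P Q ∧ E * P = P ∧ Q * E = Q := by
  have hEN : E * (A - l • 1) = (A - l • 1) * E := by
    rw [mul_sub, sub_mul, hEA]
    simp
  obtain ⟨v, r, hv, hr, hNv, hrN, hrv⟩ := exists_chain_of_rank_lt hE hEN h
  set N := A - l • (1 : Matrix (Fin n) (Fin n) ℝ) with hN
  set P : Matrix (Fin n) (Fin (k + 1)) ℝ := of fun i b => (N ^ (b : ℕ) *ᵥ v) i with hP
  set R : Matrix (Fin (k + 1)) (Fin n) ℝ := of fun a i => (r ᵥ* N ^ (k - a : ℕ)) i with hR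
  have hNv' : ∀ m, k < m → N ^ m *ᵥ v = 0 := fun m hm => by
    rw [← Nat.sub_add_cancel (Nat.succ_le_of_lt hm), pow_add, ← mulVec_mulVec, hNv, mulVec_zero]
  have hNP : N * P = P * shiftMatrix (k + 1) := by
    ext i b
    have h1 : (N * P) i b = (N ^ (b + 1 : ℕ) *ᵥ v) i := by
      rw [pow_succ', ← mulVec_mulVec]
      rfl
    rw [h1, mul_apply]
    simp only [hP, of_apply, shiftMatrix_apply, mul_ite, mul_one, mul_zero]
    by_cases hb : (b : ℕ) + 1 < k + 1
    · rw [Finset.sum_eq_single ⟨b + 1, hb⟩]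
      · simp
      · intro c _ hc
        exact if_neg fun h' => hc (Fin.ext h')
      · simp
    · rw [hNv' _ (by omega), Finset.sum_eq_zero]
      · rfl
      · intro c _
        exact if_neg (by omega)
  have hRN : R * N = shiftMatrix (k + 1) * R := by
    ext a i
    have h1 : (R * N) a i = (r ᵥ* N ^ (k - a + 1 : ℕ)) i := by
      rw [pow_succ, ← vecMul_vecMul]
      rfl
    rw [h1, mul_apply]
    simp only [hR, of_apply, shiftMatrix_apply, ite_mul, one_mul, zero_mul]
    by_cases ha : (a : ℕ) = 0
    · rw [ha, Nat.sub_zero, hrN, Finset.sum_eq_zero]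
      · rfl
      · intro c _
        exact if_neg (by omega)
    · rw [Finset.sum_eq_single ⟨a - 1, by omega⟩]
      · rw [if_pos (by simp; omega)]
        have : k - (a : ℕ) + 1 = k - (a - 1) := by omega
        rw [this]
      · intro c _ hc
        exact if_neg fun h' => hc (Fin.ext (by simp; omega))
      · simp
  have hT : ∀ a b, (R * P) a b = r ⬝ᵥ N ^ (k - a + b : ℕ) *ᵥ v := fun a b => by
    rw [pow_add, ← mulVec_mulVec, dotProduct_mulVec]
    rfl
  have hdet : (R * P).det = 1 := by
    rw [det_of_isLowerTriangular]
    · refine Finset.prod_eq_one fun a _ => ?_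
      rw [hT, Nat.sub_add_cancel (by omega), hrv]
    · intro a b hab
      have : (a : ℕ) < b := hab
      rw [hT, hNv' _ (by omega), dotProduct_zero]
  have hTu : IsUnit (R * P).det := by simp [hdet]
  have hTS : R * P * shiftMatrix (k + 1) = shiftMatrix (k + 1) * (R * P) := by
    rw [Matrix.mul_assoc, ← hNP, ← Matrix.mul_assoc, hRN, Matrix.mul_assoc]
  have hinv : (R * P)⁻¹ * shiftMatrix (k + 1) = shiftMatrix (k + 1) * (R * P)⁻¹ := by
    calc (R * P)⁻¹ * shiftMatrix (k + 1)
        = (R * P)⁻¹ * (shiftMatrix (k + 1) * (R * P)) * (R * P)⁻¹ := by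
          rw [Matrix.mul_assoc, Matrix.mul_assoc _ (R * P), mul_nonsing_inv _ hTu, Matrix.mul_one]
      _ = _ := by rw [← hTS, ← Matrix.mul_assoc, nonsing_inv_mul _ hTu, Matrix.one_mul]
  refine ⟨P, (R * P)⁻¹ * R, ⟨?_, hNP, ?_⟩, ?_, ?_⟩
  · rw [Matrix.mul_assoc, nonsing_inv_mul _ hTu]
  · rw [Matrix.mul_assoc, hRN, ← Matrix.mul_assoc, hinv, Matrix.mul_assoc]
  · ext i b
    have h1 : (E * P) i b = (E *ᵥ (N ^ (b : ℕ) *ᵥ v)) i := rfl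
    rw [h1, mulVec_mulVec, (Commute.pow_right hEN b : E * N ^ (b : ℕ) = _), ← mulVec_mulVec, hv]
    rfl
  · rw [Matrix.mul_assoc]
    congr 1
    ext a i
    have h1 : (R * E) a i = ((r ᵥ* N ^ (k - a : ℕ)) ᵥ* E) i := rfl
    rw [h1, vecMul_vecMul, ← (Commute.pow_right hEN (k - a) : E * N ^ (k - a : ℕ) = _),
      ← vecMul_vecMul, hr]
    rfl

end JordanExistence

section Paths

variable {n : ℕ} {A B C E F K : Matrix (Fin n) (Fin n) ℝ}

theorem mul_sub_smul_pow (l : ℝ) (k : ℕ) (hB : B * A = A * B) :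
    B * (A - l • 1) ^ k = (A - l • 1) ^ k * B := by
  refine (Commute.pow_right ?_ k : Commute B _)
  exact Commute.sub_right (show Commute B A from hB) ((Commute.one_right B).smul_right l)

theorem one_mem_centR (A : Matrix (Fin n) (Fin n) ℝ) : 1 ∈ CentR A :=
  ⟨isUnit_one, by rw [mul_one, one_mul]⟩

theorem mul_mem_centR (hB : B ∈ CentR A) (hC : C ∈ CentR A) : B * C ∈ CentR A :=
  ⟨hB.1.mul hC.1, by rw [← mul_assoc, hB.2, mul_assoc, hC.2, mul_assoc]⟩

theorem exists_inv_mem_centR (hB : B ∈ CentR A) : ∃ C ∈ CentR A, B * C = 1 ∧ C * B = 1 := by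
  obtain ⟨⟨u, v, huv, hvu⟩, rfl⟩ := hB.1
  refine ⟨v, ⟨⟨⟨v, u, hvu, huv⟩, rfl⟩, ?_⟩, huv, hvu⟩
  have h : A * u = u * A := hB.2
  calc A * v = v * (u * A) * v := by rw [← mul_assoc, hvu, one_mul]
    _ = v * A := by rw [← h, mul_assoc, mul_assoc, huv, mul_one]

theorem one_sub_two_mul_mem_centR (hE : E * E = E) (hEA : E * A = A * E) :
    1 - 2 * E ∈ CentR A := by
  have h : (1 - 2 * E) * (1 - 2 * E) = 1 := by
    calc (1 - 2 * E) * (1 - 2 * E) = 1 - 4 * E + 4 * (E * E) := by noncomm_ring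
      _ = 1 := by rw [hE]; noncomm_ring
  refine ⟨⟨⟨_, _, h, h⟩, rfl⟩, ?_⟩
  calc A * (1 - 2 * E) = A - 2 * (A * E) := by noncomm_ring
    _ = (1 - 2 * E) * A := by rw [← hEA]; noncomm_ring

theorem joinedIn_mul_left (hB : B ∈ CentR A) {C D : Matrix (Fin n) (Fin n) ℝ}
    (h : JoinedIn (CentR A) C D) : JoinedIn (CentR A) (B * C) (B * D) :=
  (h.map (continuous_const_mul B)).mono (by
    rintro _ ⟨X, hX, rfl⟩
    exact mul_mem_centR hB hX)

theorem joinedIn_one_mul (hB : JoinedIn (CentR A) 1 B) (hC : JoinedIn (CentR A) 1 C) :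
    JoinedIn (CentR A) 1 (B * C) := by
  have := joinedIn_mul_left hB.mem.2 hC
  rw [mul_one] at this
  exact hB.trans this

/-- If some `K` in the commutant of `A` has no real eigenvalue on the range of the idempotent `F`,
the involution `1 - 2 * F` can be joined to the identity by rotating along `K`. -/
theorem joinedIn_one_of_no_eigenvector (hF : F * F = F) (hFA : F * A = A * F)
    (hKA : K * A = A * K) (hFK : F * K = K * F)
    (hK : ∀ (c : ℝ) w, F *ᵥ w = w → K *ᵥ w = c • w → w = 0) :
    JoinedIn (CentR A) 1 (1 - 2 * F) := by
  refine JoinedIn.ofLine (f := fun t : ℝ => 1 - F + F *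
    (Real.cos (Real.pi * t) • (1 : Matrix (Fin n) (Fin n) ℝ) + Real.sin (Real.pi * t) • K))
    (by fun_prop) (by simp) (by simp; noncomm_ring) ?_
  rintro _ ⟨t, -, rfl⟩
  set c := Real.cos (Real.pi * t)
  set s := Real.sin (Real.pi * t)
  have hcs : s ^ 2 + c ^ 2 = 1 := Real.sin_sq_add_cos_sq _
  constructor
  · refine isUnit_of_mulVec_eq_zero fun v hv => ?_
    set Z := 1 - F + F * (c • (1 : Matrix (Fin n) (Fin n) ℝ) + s • K) with hZ
    have h1 : (1 - F) * Z = 1 - F := by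
      have : (1 - F) * Z = 1 - F - F + F * F + (F - F * F) * (c • 1 + s • K) := by
        rw [hZ]; noncomm_ring
      rw [this, hF, sub_self, zero_mul]; noncomm_ring
    have h2 : F * Z = (c • 1 + s • K) * F := by
      have : F * Z = F - F * F + F * F * (c • 1 + s • K) := by
        rw [hZ]; noncomm_ring
      rw [this, hF, sub_self, zero_add, mul_add, add_mul, mul_smul_comm, mul_smul_comm, hFK]
      simp
    have h3 : F *ᵥ v = v := by
      have : (1 - F) *ᵥ v = 0 := by
        rw [← h1, ← mulVec_mulVec, hv, mulVec_zero]
      rw [sub_mulVec, one_mulVec, sub_eq_zero] at this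
      exact this.symm
    have h4 : c • v + s • K *ᵥ v = 0 := by
      have : (F * Z) *ᵥ v = 0 := by rw [← mulVec_mulVec, hv, mulVec_zero]
      rw [h2, ← mulVec_mulVec, h3, add_mulVec, smul_mulVec, smul_mulVec, one_mulVec] at this
      exact this
    by_cases hs : s = 0
    · have hc : c ≠ 0 := by
        rintro hc
        simp [hs, hc] at hcs
      simpa [hs, hc] using h4
    · refine hK (-(s⁻¹ * c)) v h3 ?_
      have h5 : s⁻¹ • (c • v + s • K *ᵥ v) = 0 := by rw [h4, smul_zero]
      rw [smul_add, smul_smul, smul_smul, inv_mul_cancel₀ hs, one_smul] at h5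
      rw [neg_smul]
      exact eq_neg_of_add_eq_zero_right h5
  · have h1 : A * (c • (1 : Matrix (Fin n) (Fin n) ℝ) + s • K) = (c • 1 + s • K) * A := by
      rw [mul_add, add_mul, mul_smul_comm, mul_smul_comm, smul_mul_assoc, smul_mul_assoc, hKA]
      simp
    calc A * (1 - F + F * (c • 1 + s • K))
        = A - A * F + A * F * (c • 1 + s • K) := by noncomm_ring
      _ = A - F * A + F * (A * (c • 1 + s • K)) := by rw [← hFA]; noncomm_ring
      _ = _ := by rw [h1]; noncomm_ring

/-- Two isomorphic Jordan blocks can be flipped simultaneously inside the identity component. -/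
theorem joinedIn_one_of_pair {j : ℕ} {l : ℝ} {P P' : Matrix (Fin n) (Fin j) ℝ}
    {Q Q' : Matrix (Fin j) (Fin n) ℝ} (h : IsJordanSummand A l P Q)
    (h' : IsJordanSummand A l P' Q') (hQP' : Q * P' = 0) (hQ'P : Q' * P = 0) :
    JoinedIn (CentR A) 1 (1 - 2 * (P * Q + P' * Q')) := by
  have key : ∀ {X Y : Matrix (Fin n) (Fin j) ℝ} {Z W : Matrix (Fin j) (Fin n) ℝ},
      X * Z * (Y * W) = X * (Z * Y) * W := fun {X Y Z W} => by
    simp only [Matrix.mul_assoc]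
  have e1 : P * Q * (P' * Q') = 0 := by simp [key, hQP']
  have e2 : P' * Q' * (P * Q) = 0 := by simp [key, hQ'P]
  have e3 : P * Q * (P * Q') = P * Q' := by simp [key, h.mul_eq_one]
  have e4 : P * Q * (P' * Q) = 0 := by simp [key, hQP']
  have e5 : P' * Q' * (P * Q') = 0 := by simp [key, hQ'P]
  have e6 : P' * Q' * (P' * Q) = P' * Q := by simp [key, h'.mul_eq_one]
  have e7 : P * Q' * (P * Q) = 0 := by simp [key, hQ'P]
  have e8 : P' * Q * (P * Q) = P' * Q := by simp [key, h.mul_eq_one]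
  have e9 : P * Q' * (P' * Q') = P * Q' := by simp [key, h'.mul_eq_one]
  have e10 : P' * Q * (P' * Q') = 0 := by simp [key, hQP']
  have e11 : P * Q' * (P * Q') = 0 := by simp [key, hQ'P]
  have e12 : P * Q' * (P' * Q) = P * Q := by simp [key, h'.mul_eq_one]
  have e13 : P' * Q * (P * Q') = P' * Q' := by simp [key, h.mul_eq_one]
  have e14 : P' * Q * (P' * Q) = 0 := by simp [key, hQP']
  have hJ : (P * Q' - P' * Q) * (P * Q' - P' * Q) = -(P * Q + P' * Q') := by
    rw [sub_mul, mul_sub, mul_sub, e11, e12, e13, e14]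
    abel
  refine joinedIn_one_of_no_eigenvector (K := P * Q' - P' * Q) ?_ ?_ ?_ ?_ ?_
  · rw [add_mul, mul_add, mul_add, h.mul_mul_mul, h'.mul_mul_mul, e1, e2, add_zero, zero_add]
  · rw [add_mul, mul_add, h.commute_mul h, h'.commute_mul h']
  · rw [sub_mul, mul_sub, h.commute_mul h', h'.commute_mul h]
  · simp only [add_mul, mul_add, mul_sub, sub_mul, e3, e4, e5, e6, e7, e8, e9, e10]
    abel
  · intro c w hFw hKw
    have h1 : (P * Q' - P' * Q) *ᵥ ((P * Q' - P' * Q) *ᵥ w) = -w := by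
      rw [mulVec_mulVec, hJ, neg_mulVec, hFw]
    rw [hKw, mulVec_smul, hKw, smul_smul] at h1
    have h2 : (c * c + 1) • w = 0 := by rw [add_smul, h1, one_smul, neg_add_cancel]
    exact (smul_eq_zero.1 h2).resolve_left
      (by nlinarith [mul_self_nonneg c] : (0 : ℝ) < c * c + 1).ne'

theorem joinedIn_one_of_even (hE : E * E = E) (hEA : E * A = A * E)
    (h : ∀ (l : ℝ) (k : ℕ), 2 * (E * (A - l • 1) ^ (k + 1)).rank <
      (E * (A - l • 1) ^ k).rank + (E * (A - l • 1) ^ (k + 2)).rank →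
      Even ((E * (A - l • 1) ^ k).rank + (E * (A - l • 1) ^ (k + 2)).rank)) :
    JoinedIn (CentR A) 1 (1 - 2 * E) := by
  induction hd : E.rank using Nat.strong_induction_on generalizing E with
  | _ d ih =>
  subst hd
  by_cases hex : ∃ (l : ℝ) (k : ℕ), 2 * (E * (A - l • 1) ^ (k + 1)).rank <
      (E * (A - l • 1) ^ k).rank + (E * (A - l • 1) ^ (k + 2)).rank
  · obtain ⟨l, k, hlk⟩ := hex
    have hev := h l k hlk
    obtain ⟨P, Q, hPQ, hEP, hQE⟩ := exists_isJordanSummand hE hEA hlk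
    have split : ∀ {G : Matrix (Fin n) (Fin n) ℝ} {P : Matrix (Fin n) (Fin (k + 1)) ℝ}
        {Q : Matrix (Fin (k + 1)) (Fin n) ℝ}, G * G = G → G * A = A * G →
        IsJordanSummand A l P Q → G * P = P → Q * G = Q →
        (G - P * Q) * (G - P * Q) = G - P * Q ∧ (G - P * Q) * A = A * (G - P * Q) ∧
        P * Q * (G - P * Q) = 0 ∧ ∀ (m : ℝ) (i : ℕ), (G * (A - m • 1) ^ i).rank =
          (P * Q * (A - m • 1) ^ i).rank + ((G - P * Q) * (A - m • 1) ^ i).rank := by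
      intro G P Q hG hGA hPQ hGP hQG
      have h1 : P * Q * G = P * Q := by rw [Matrix.mul_assoc, hQG]
      have h2 : G * (P * Q) = P * Q := by rw [← Matrix.mul_assoc, hGP]
      have h3 : (G - P * Q) * (G - P * Q) = G - P * Q := by
        rw [sub_mul, mul_sub, mul_sub, hG, h1, h2, hPQ.mul_mul_mul]
        abel
      have h4 : (G - P * Q) * A = A * (G - P * Q) := by
        rw [sub_mul, mul_sub, hGA, hPQ.commute_mul hPQ]
      have h5 : P * Q * (G - P * Q) = 0 := by rw [mul_sub, h1, hPQ.mul_mul_mul, sub_self]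
      have h6 : (G - P * Q) * (P * Q) = 0 := by rw [sub_mul, h2, hPQ.mul_mul_mul, sub_self]
      refine ⟨h3, h4, h5, fun m i => ?_⟩
      rw [← rank_add_mul_of_orthogonal hPQ.mul_mul_mul h3 h5 h6
        (mul_sub_smul_pow m i (hPQ.commute_mul hPQ).symm) (mul_sub_smul_pow m i h4), add_sub_cancel]
    obtain ⟨hG, hGA, hPG, hrk⟩ := split hE hEA hPQ hEP hQE
    set G := E - P * Q with hGdef
    have hlk' : 2 * (G * (A - l • 1) ^ (k + 1)).rank <
        (G * (A - l • 1) ^ k).rank + (G * (A - l • 1) ^ (k + 2)).rank := by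
      have r0 := hrk l k
      have r1 := hrk l (k + 1)
      have r2 := hrk l (k + 2)
      rw [hPQ.rank_mul_pow_self] at r0 r1 r2
      obtain ⟨e, he⟩ := hev
      omega
    obtain ⟨P', Q', hPQ', hGP', hQG'⟩ := exists_isJordanSummand hG hGA hlk'
    obtain ⟨hH, hHA, hPH, hrk'⟩ := split hG hGA hPQ' hGP' hQG'
    have hGP : G * P = 0 := by
      rw [hGdef, Matrix.sub_mul, hEP, Matrix.mul_assoc, hPQ.mul_eq_one, Matrix.mul_one, sub_self]
    have hQG : Q * G = 0 := by
      rw [hGdef, Matrix.mul_sub, hQE, ← Matrix.mul_assoc, hPQ.mul_eq_one, Matrix.one_mul, sub_self]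
    have hQP' : Q * P' = 0 := by rw [← hGP', ← Matrix.mul_assoc, hQG, Matrix.zero_mul]
    have hQ'P : Q' * P = 0 := by rw [← hQG', Matrix.mul_assoc, hGP, Matrix.mul_zero]
    set H := G - P' * Q' with hHdef
    have hrr : ∀ (m : ℝ) (i : ℕ), (P' * Q' * (A - m • 1) ^ i).rank =
        (P * Q * (A - m • 1) ^ i).rank := fun m i => by
      rw [hPQ.rank_mul_pow, hPQ'.rank_mul_pow]
    have htot : ∀ (m : ℝ) (i : ℕ), (E * (A - m • 1) ^ i).rank =
        2 * (P * Q * (A - m • 1) ^ i).rank + (H * (A - m • 1) ^ i).rank := fun m i => by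
      rw [hrk, hrk', hrr]
      ring
    have hHjoin : JoinedIn (CentR A) 1 (1 - 2 * H) := by
      refine ih _ ?_ hH hHA ?_ rfl
      · have h1 := htot l 0
        rw [hPQ.rank_mul_pow_self, pow_zero, mul_one, mul_one] at h1
        omega
      · intro m i hmi
        have h0 := htot m i
        have h1 := htot m (i + 1)
        have h2 := htot m (i + 2)
        have h3 := two_mul_rank_mul_pow_le (E := P * Q) (N := A - m • 1)
          (by simpa using mul_sub_smul_pow m 1 (hPQ.commute_mul hPQ).symm) i
        have h4 := h m i (by omega)
        rw [h0, h2] at h4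
        obtain ⟨e, he⟩ := h4
        refine ⟨e - (P * Q * (A - m • 1) ^ i).rank - (P * Q * (A - m • 1) ^ (i + 2)).rank, ?_⟩
        omega
    have hprod : (1 - 2 * (P * Q + P' * Q')) * (1 - 2 * H) = 1 - 2 * E := by
      have e1 : P * Q * H = 0 := by
        rw [hHdef, mul_sub, hPG, ← Matrix.mul_assoc, Matrix.mul_assoc P, hQP', Matrix.mul_zero,
          Matrix.zero_mul, sub_zero]
      calc _ = 1 - 2 * (P * Q + P' * Q' + H) + 4 * (P * Q * H + P' * Q' * H) := by noncomm_ring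
        _ = 1 - 2 * E := by
          have e2 : P * Q + P' * Q' + H = E := by
            rw [hHdef, hGdef]
            abel
          rw [e1, hPH, e2]
          noncomm_ring
    rw [← hprod]
    exact joinedIn_one_mul (joinedIn_one_of_pair hPQ hPQ' hQP' hQ'P) hHjoin
  · refine joinedIn_one_of_no_eigenvector (K := A) hE hEA rfl hEA fun c w hw hAw => ?_
    by_contra hw0
    obtain ⟨k, hk⟩ := exists_rank_lt_of_eigenvector (N := A - c • 1)
      (by simpa using mul_sub_smul_pow c 1 hEA) hw0 hw (by
        rw [sub_mulVec, hAw, smul_mulVec, one_mulVec, sub_self])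
    exact hex ⟨c, k, hk⟩

end Paths

section Spectral

open Polynomial in
theorem exists_coprime_factorization {K : Type*} [Field K] {p : K[X]} (hp : p ≠ 0) (S : K → Prop) :
    ∃ a b : K[X], a * b = p ∧ IsCoprime a b ∧ (∀ r, a.eval r = 0 → S r) ∧
      ∀ r, b.eval r = 0 → ¬ S r := by
  classical
  obtain ⟨q, hq, -, hqr⟩ := exists_prod_multiset_X_sub_C_mul p
  have hq0 : q ≠ 0 := by
    rintro rfl
    exact hp (by rw [← hq, mul_zero])
  have hev : ∀ (s : Multiset K) (r : K), (s.map fun c => X - C c).prod.eval r = 0 → r ∈ s := by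
    intro s r h
    rw [eval_multiset_prod, Multiset.map_map] at h
    obtain ⟨c, hc, hc0⟩ := Multiset.mem_map.1 (Multiset.prod_eq_zero_iff.1 h)
    simp only [Function.comp_apply, eval_sub, eval_X, eval_C, sub_eq_zero] at hc0
    rwa [hc0]
  have hb : ∀ r, ((((p.roots.filter fun r => ¬ S r).map fun c => X - C c).prod) * q).eval r = 0 →
      ¬ S r := by
    intro r h
    rw [eval_mul, mul_eq_zero] at h
    rcases h with h | h
    · exact (Multiset.mem_filter.1 (hev _ _ h)).2
    · have : r ∈ q.roots := (mem_roots hq0).2 h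
      simp [hqr] at this
  refine ⟨((p.roots.filter S).map fun c => X - C c).prod, _, ?_, ?_,
    fun r h => (Multiset.mem_filter.1 (hev _ _ h)).2, hb⟩
  · conv_rhs => rw [← hq]
    rw [← mul_assoc, ← Multiset.prod_add, ← Multiset.map_add, Multiset.filter_add_not]
  · have : ∀ s : Multiset K, (∀ r ∈ s, S r) → IsCoprime (s.map fun c => X - C c).prod
        (((p.roots.filter fun r => ¬ S r).map fun c => X - C c).prod * q) := by
      intro s
      induction s using Multiset.induction_on with
      | empty => exact fun _ => by simpa using isCoprime_one_left
      | cons r s ih =>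
        intro hs
        rw [Multiset.map_cons, Multiset.prod_cons]
        refine IsCoprime.mul_left ?_ (ih fun c hc => hs c (Multiset.mem_cons_of_mem hc))
        refine ((irreducible_X_sub_C r).coprime_iff_not_dvd).2 fun hd => ?_
        exact hb r (dvd_iff_isRoot.1 hd) (hs r (Multiset.mem_cons_self r s))
    exact this _ fun r hr => (Multiset.mem_filter.1 hr).2

variable {n : ℕ} {A B : Matrix (Fin n) (Fin n) ℝ}

open Polynomial in
theorem aeval_mulVec_of_eigenvector {w : Fin n → ℝ} {r : ℝ} (h : B *ᵥ w = r • w) (f : ℝ[X]) :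
    aeval B f *ᵥ w = f.eval r • w := by
  obtain ⟨g, hg⟩ := X_sub_C_dvd_sub_C_eval (a := r) (p := f)
  have h1 : aeval B f = aeval B g * (B - r • 1) + f.eval r • 1 := by
    have := congrArg (aeval (R := ℝ) B) (sub_eq_iff_eq_add.1 hg)
    rw [this, mul_comm, map_add, map_mul, map_sub, aeval_X, aeval_C, aeval_C,
      Algebra.algebraMap_eq_smul_one, Algebra.algebraMap_eq_smul_one]
  rw [h1, add_mulVec, ← mulVec_mulVec, sub_mulVec, h]
  simp [smul_mulVec]

open Polynomial in
/-- Every element of the centralizer can be joined to an involution `1 - 2 * E`, where `E` is the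
spectral projection onto the negative eigenvalues. -/
theorem exists_idempotent_joinedIn (hB : B ∈ CentR A) :
    ∃ E, E * E = E ∧ E * A = A * E ∧ JoinedIn (CentR A) (1 - 2 * E) B := by
  obtain ⟨a, b, hab, ⟨u, v, huv⟩, ha, hb⟩ :=
    exists_coprime_factorization B.charpoly_monic.ne_zero (· < 0)
  have hab0 : aeval B a * aeval B b = 0 := by rw [← map_mul, hab, aeval_self_charpoly]
  set E := aeval B (v * b) with hEdef
  have hE1 : 1 - E = aeval B (u * a) := by
    rw [hEdef, ← map_one (aeval (R := ℝ) B), ← map_sub, ← huv, add_sub_cancel_right]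
  have haE : aeval B a * E = 0 := by
    rw [hEdef, ← map_mul, show a * (v * b) = v * (a * b) by ring, map_mul, hab,
      aeval_self_charpoly, mul_zero]
  have hbE : aeval B b * (1 - E) = 0 := by
    rw [hE1, ← map_mul, show b * (u * a) = u * (a * b) by ring, map_mul, hab,
      aeval_self_charpoly, mul_zero]
  have hE : E * E = E := by
    have : (1 - E) * E = 0 := by rw [hE1, map_mul, mul_assoc, haE, mul_zero]
    rw [sub_mul, one_mul, sub_eq_zero] at this
    exact this.symm
  have hcomm : ∀ f : ℝ[X], A * aeval B f = aeval B f * A := fun f => by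
    induction f using Polynomial.induction_on' with
    | add p q hp hq => rw [map_add, mul_add, add_mul, hp, hq]
    | monomial k c =>
      rw [aeval_monomial, ← Algebra.smul_def, mul_smul_comm, smul_mul_assoc,
        ((show Commute A B from hB.2).pow_right k).eq]
  have hBE : B * E = E * B := by
    simpa [hEdef] using congrArg (aeval (R := ℝ) B) (mul_comm X (v * b))
  have hva : ∀ {w : Fin n → ℝ} {r : ℝ}, 0 ≤ r → E *ᵥ w = w → B *ᵥ w = r • w → w = 0 := by
    intro w r hr hw hBw
    have h1 := aeval_mulVec_of_eigenvector hBw a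
    rw [← hw, mulVec_mulVec, haE, zero_mulVec, hw] at h1
    exact (smul_eq_zero.1 h1.symm).resolve_left fun h => (ha r h).not_ge hr
  have hvb : ∀ {w : Fin n → ℝ} {r : ℝ}, r < 0 → (1 - E) *ᵥ w = w → B *ᵥ w = r • w → w = 0 := by
    intro w r hr hw hBw
    have h1 := aeval_mulVec_of_eigenvector hBw b
    rw [← hw, mulVec_mulVec, hbE, zero_mulVec, hw] at h1
    exact (smul_eq_zero.1 h1.symm).resolve_left fun h => hb r h hr
  have hinj : ∀ {w : Fin n → ℝ}, B *ᵥ w = 0 → w = 0 := by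
    intro w hw
    obtain ⟨C, -, -, hCB⟩ := exists_inv_mem_centR hB
    rw [← one_mulVec w, ← hCB, ← mulVec_mulVec, hw, mulVec_zero]
  refine ⟨E, hE, (hcomm _).symm, JoinedIn.symm (JoinedIn.ofLine
    (f := fun t : ℝ => (1 - t) • B + t • (1 - 2 * E)) (by fun_prop) (by simp) (by simp) ?_)⟩
  rintro _ ⟨t, ⟨ht0, ht1⟩, rfl⟩
  constructor
  · refine isUnit_of_mulVec_eq_zero fun x hx => ?_
    dsimp only at hx
    have key : ∀ (F : Matrix (Fin n) (Fin n) ℝ) (c : ℝ), F * B = B * F →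
        F * (1 - 2 * E) = c • F → (1 - t) • B *ᵥ (F *ᵥ x) = -(t * c) • F *ᵥ x := by
      intro F c hFB hFE
      have h1 : (F * ((1 - t) • B + t • (1 - 2 * E))) *ᵥ x = 0 := by
        rw [← mulVec_mulVec, hx, mulVec_zero]
      rw [mul_add, mul_smul_comm, mul_smul_comm, hFB, hFE, smul_smul, add_mulVec, smul_mulVec,
        smul_mulVec, ← mulVec_mulVec] at h1
      rw [neg_smul]
      exact eq_neg_of_add_eq_zero_left h1
    have h1 := key E (-1) hBE.symm (by
      rw [show E * (1 - 2 * E) = E - 2 * (E * E) by noncomm_ring, hE]; simp [two_mul])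
    have h2 := key (1 - E) 1 (by rw [sub_mul, mul_sub, hBE]; simp) (by
      rw [show (1 - E) * (1 - 2 * E) = 1 - E - 2 * E + 2 * (E * E) by noncomm_ring, hE]; simp)
    rw [mul_neg_one, neg_neg] at h1
    rw [mul_one] at h2
    have h3 : E *ᵥ x = 0 := by
      rcases ht1.eq_or_lt with rfl | ht
      · simpa using h1.symm
      · have ht' : 0 < 1 - t := by linarith
        refine hva (r := (1 - t)⁻¹ * t) (by positivity) (by rw [mulVec_mulVec, hE]) ?_
        rw [← smul_smul, ← h1, smul_smul, inv_mul_cancel₀ ht'.ne', one_smul]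
    have h4 : (1 - E) *ᵥ x = 0 := by
      rcases ht1.eq_or_lt with rfl | ht
      · simpa using h2.symm
      · have ht' : 0 < 1 - t := by linarith
        rcases ht0.eq_or_lt with rfl | ht0
        · exact hinj (by simpa using h2)
        · refine hvb (r := (1 - t)⁻¹ * -t) ?_ ?_ ?_
          · have : 0 < (1 - t)⁻¹ * t := by positivity
            linarith
          · rw [mulVec_mulVec, show (1 - E) * (1 - E) = 1 - E - E + E * E by noncomm_ring, hE,
              sub_add_cancel]
          · rw [← smul_smul, ← h2, smul_smul, inv_mul_cancel₀ ht'.ne', one_smul]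
    rw [sub_mulVec, h3, sub_zero, one_mulVec] at h4
    exact h4
  · dsimp only
    rw [mul_add, add_mul, mul_smul_comm, mul_smul_comm, smul_mul_assoc, smul_mul_assoc, hB.2]
    congr 2
    calc A * (1 - 2 * E) = A - 2 * (A * E) := by noncomm_ring
      _ = (1 - 2 * E) * A := by rw [hcomm]; noncomm_ring

end Spectral

section Components

variable {n : ℕ} {A B : Matrix (Fin n) (Fin n) ℝ} {p q : ℝ × ℕ}
  {s : Matrix (Fin n) (Fin n) ℝ → ℝ}

/-- The pairs `(l, j)` such that `A` has a `j × j` Jordan block with real eigenvalue `l`. -/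
def jordanIndices (A : Matrix (Fin n) (Fin n) ℝ) : Set (ℝ × ℕ) :=
  {p : ℝ × ℕ | 1 ≤ p.2 ∧ p.2 ≤ n ∧
    2 * ((A - p.1 • 1) ^ p.2).rank <
      ((A - p.1 • 1) ^ (p.2 - 1)).rank + ((A - p.1 • 1) ^ (p.2 + 1)).rank}

/-- A continuous character of the centralizer of `A` whose value at the involution `1 - 2 * E` is
the parity of the number of Jordan blocks of type `p` in the range of `E`. -/
structure IsBlockSign (A : Matrix (Fin n) (Fin n) ℝ) (p : ℝ × ℕ)
    (s : Matrix (Fin n) (Fin n) ℝ → ℝ) : Prop where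
  continuous : Continuous s
  map_one : s 1 = 1
  map_mul : ∀ {B C}, B ∈ CentR A → C ∈ CentR A → s (B * C) = s B * s C
  map_one_sub : ∀ {E}, E * E = E → E * A = A * E → s (1 - 2 * E) =
    (-1) ^ ((E * (A - p.1 • 1) ^ (p.2 - 1)).rank + (E * (A - p.1 • 1) ^ (p.2 + 1)).rank)

theorem exists_isBlockSign (A : Matrix (Fin n) (Fin n) ℝ) (p : ℝ × ℕ) :
    ∃ s, IsBlockSign A p s := by
  obtain ⟨D, hD, hD1, hDm, hDE⟩ := exists_det_on_range ((A - p.1 • 1) ^ (p.2 - 1))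
  obtain ⟨D', hD', hD1', hDm', hDE'⟩ := exists_det_on_range ((A - p.1 • 1) ^ (p.2 + 1))
  refine ⟨fun B => D B * D' B, hD.mul hD', by rw [hD1, hD1', one_mul], ?_, ?_⟩
  · intro B C hB hC
    rw [hDm _ _ (mul_sub_smul_pow _ _ hB.2.symm) (mul_sub_smul_pow _ _ hC.2.symm),
      hDm' _ _ (mul_sub_smul_pow _ _ hB.2.symm) (mul_sub_smul_pow _ _ hC.2.symm),
      mul_mul_mul_comm]
  · intro E hE hEA
    rw [hDE E hE (mul_sub_smul_pow _ _ hEA), hDE' E hE (mul_sub_smul_pow _ _ hEA), ← pow_add]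

namespace IsBlockSign

theorem ne_zero (h : IsBlockSign A p s) (hB : B ∈ CentR A) : s B ≠ 0 := by
  obtain ⟨C, hC, hBC, -⟩ := exists_inv_mem_centR hB
  intro h0
  have := h.map_mul hB hC
  rw [hBC, h.map_one, h0, zero_mul] at this
  exact one_ne_zero this

theorem continuous_decide (h : IsBlockSign A p s) :
    Continuous fun B : CentR A => decide (0 < s B) := by
  have hs : Continuous fun B : CentR A => s B := h.continuous.comp continuous_subtype_val
  refine (continuous_bool_rng true).2 ⟨?_, ?_⟩
  · convert isClosed_le continuous_const hs using 1
    ext B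
    simpa using (h.ne_zero B.2).symm.le_iff_lt.symm
  · convert isOpen_lt (continuous_const (y := (0 : ℝ))) hs using 1
    ext B
    simp

theorem pos_iff_of_joinedIn (h : IsBlockSign A p s) {C : Matrix (Fin n) (Fin n) ℝ}
    (hBC : JoinedIn (CentR A) B C) : 0 < s B ↔ 0 < s C := by
  have := h.continuous_decide.image_eq_of_connectedComponent_eq _ _
    (connectedComponent_eq (pathComponent_subset_component _ hBC.joined_subtype))
  simpa using this

end IsBlockSign

theorem jordanIndices_finite (A : Matrix (Fin n) (Fin n) ℝ) : (jordanIndices A).Finite := by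
  refine (A.finite_spectrum.prod (Set.finite_Iic n)).subset ?_
  rintro ⟨l, j⟩ ⟨-, hj, hlt⟩
  refine ⟨?_, hj⟩
  by_contra hl
  rw [spectrum.notMem_iff, Algebra.algebraMap_eq_smul_one, ← IsUnit.neg_iff, neg_sub] at hl
  simp only [rank_of_isUnit _ (hl.pow _)] at hlt
  omega

theorem mem_jordanIndices_of_rank_lt {E : Matrix (Fin n) (Fin n) ℝ} (hE : E * E = E)
    (hEA : E * A = A * E) {l : ℝ} {k : ℕ}
    (h : 2 * (E * (A - l • 1) ^ (k + 1)).rank <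
      (E * (A - l • 1) ^ k).rank + (E * (A - l • 1) ^ (k + 2)).rank) :
    (l, k + 1) ∈ jordanIndices A := by
  obtain ⟨P, Q, hPQ, -, -⟩ := exists_isJordanSummand hE hEA h
  refine ⟨by simp, hPQ.le_card, ?_⟩
  have hF : (1 - E) * (1 - E) = 1 - E := by
    rw [show (1 - E) * (1 - E) = 1 - E - E + E * E by noncomm_ring, hE, sub_add_cancel]
  have hFA : (1 - E) * A = A * (1 - E) := by rw [sub_mul, mul_sub, hEA]; simp
  have hrk : ∀ i, ((A - l • 1) ^ i).rank =
      (E * (A - l • 1) ^ i).rank + ((1 - E) * (A - l • 1) ^ i).rank := fun i => by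
    rw [← rank_add_mul_of_orthogonal hE hF (by rw [mul_sub, hE]; simp)
      (by rw [sub_mul, hE]; simp) (mul_sub_smul_pow l i hEA) (mul_sub_smul_pow l i hFA)]
    simp
  have hconv := two_mul_rank_mul_pow_le (E := 1 - E) (N := A - l • 1)
    (by simpa using mul_sub_smul_pow l 1 hFA) k
  simp only [Nat.add_sub_cancel, hrk, add_assoc, one_add_one_eq_two]
  omega

theorem joinedIn_one_of_blockSign_pos {σ : ℝ × ℕ → Matrix (Fin n) (Fin n) ℝ → ℝ}
    (hσ : ∀ p, IsBlockSign A p (σ p)) (hB : B ∈ CentR A)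
    (h : ∀ p ∈ jordanIndices A, 0 < σ p B) : JoinedIn (CentR A) 1 B := by
  obtain ⟨E, hE, hEA, hEB⟩ := exists_idempotent_joinedIn hB
  refine (joinedIn_one_of_even hE hEA fun l k hlk => ?_).trans hEB
  have h1 := ((hσ (l, k + 1)).pos_iff_of_joinedIn hEB).2
    (h _ (mem_jordanIndices_of_rank_lt hE hEA hlk))
  rw [(hσ (l, k + 1)).map_one_sub hE hEA] at h1
  by_contra hodd
  dsimp only at h1
  rw [Nat.add_sub_cancel, (Nat.not_even_iff_odd.1 hodd).neg_one_pow] at h1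
  norm_num at h1

theorem exists_blockSign_eq_ite (hp : p ∈ jordanIndices A) : ∃ C ∈ CentR A,
    ∀ q s, 1 ≤ q.2 → IsBlockSign A q s → s C = if q = p then -1 else 1 := by
  obtain ⟨l, j⟩ := p
  obtain ⟨h1, -, hlt⟩ := hp
  obtain ⟨k, rfl⟩ : ∃ k, j = k + 1 := ⟨j - 1, by simp at h1; omega⟩
  obtain ⟨P, Q, hPQ, -, -⟩ := exists_isJordanSummand (A := A) (l := l) (one_mul 1)
    ((one_mul A).trans (mul_one A).symm) (k := k) (by simpa using hlt)
  have hcomm := (hPQ.commute_mul hPQ).symm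
  refine ⟨1 - 2 * (P * Q), one_sub_two_mul_mem_centR hPQ.mul_mul_mul hcomm, ?_⟩
  rintro ⟨m, i⟩ s hi hs
  dsimp only at hi
  rw [hs.map_one_sub hPQ.mul_mul_mul hcomm]
  by_cases hm : m = l
  · subst hm
    rw [hPQ.rank_mul_pow_self, hPQ.rank_mul_pow_self]
    by_cases hik : i = k + 1
    · subst hik
      rw [if_pos rfl]
      refine Odd.neg_one_pow ⟨0, ?_⟩
      dsimp only
      omega
    · rw [if_neg (by simpa using hik)]
      refine Even.neg_one_pow ⟨k + 1 - i, ?_⟩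
      dsimp only
      omega
  · rw [hPQ.rank_mul_pow_of_ne hm, hPQ.rank_mul_pow_of_ne hm, if_neg (by simp [hm])]
    exact Even.neg_one_pow ⟨k + 1, rfl⟩

theorem exists_blockSign_pos_iff {T : Set (ℝ × ℕ)} (hT : T ⊆ jordanIndices A) : ∃ B ∈ CentR A,
    ∀ q s, 1 ≤ q.2 → IsBlockSign A q s → (0 < s B ↔ q ∉ T) := by
  induction T, (jordanIndices_finite A).subset hT using Set.Finite.induction_on with
  | empty => exact ⟨1, one_mem_centR A, fun q s _ hs => by simp [hs.map_one]⟩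
  | @insert p T hp _ ih =>
    obtain ⟨B, hB, hBs⟩ := ih ((Set.subset_insert p T).trans hT)
    obtain ⟨C, hC, hCs⟩ := exists_blockSign_eq_ite (hT (Set.mem_insert p T))
    refine ⟨C * B, mul_mem_centR hC hB, fun q s hq hs => ?_⟩
    rw [hs.map_mul hC hB, hCs q s hq hs]
    have := hBs q s hq hs
    by_cases hqp : q = p
    · subst hqp
      simpa using (this.2 hp).le
    · simp [hqp, this]

end Components

/-- The number of connected components of `Cent_ℝ(A)` is `2 ^ γ(A)`. -/
theorem card_components_centralizer {n : ℕ} (A : Matrix (Fin n) (Fin n) ℝ) :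
    Nat.card (ConnectedComponents (CentR A)) = 2 ^ gammaOf A := by
  choose σ hσ using exists_isBlockSign A
  let χ : CentR A → jordanIndices A → Bool := fun B p => decide (0 < σ p B)
  have hχ : Continuous χ := continuous_pi fun p => (hσ p).continuous_decide
  have hinj : Function.Injective hχ.connectedComponentsLift := by
    intro x y
    obtain ⟨B, rfl⟩ := ConnectedComponents.surjective_coe x
    obtain ⟨C, rfl⟩ := ConnectedComponents.surjective_coe y
    rw [hχ.connectedComponentsLift_apply_coe, hχ.connectedComponentsLift_apply_coe]
    intro h
    obtain ⟨D, hD, hBD, hDB⟩ := exists_inv_mem_centR B.2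
    have h1 : JoinedIn (CentR A) 1 (D * C) := by
      refine joinedIn_one_of_blockSign_pos hσ (mul_mem_centR hD C.2) fun p hp => ?_
      have h2 : 0 < σ p B ↔ 0 < σ p C := by simpa [χ] using congrFun h ⟨p, hp⟩
      have h3 : σ p D * σ p B = 1 := by rw [← (hσ p).map_mul hD B.2, hDB, (hσ p).map_one]
      rw [(hσ p).map_mul hD C.2]
      have h4 := (hσ p).ne_zero C.2
      rcases lt_or_gt_of_ne h4 with h5 | h5
      · have h6 : ¬ 0 < σ p B := fun h6 => h5.not_gt (h2.1 h6)
        exact mul_pos_of_neg_of_neg (by nlinarith) h5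
      · exact mul_pos (pos_of_mul_pos_left (h3 ▸ one_pos) (h2.2 h5).le) h5
    have h2 := joinedIn_mul_left B.2 h1
    rw [mul_one, ← mul_assoc, hBD, one_mul] at h2
    rw [ConnectedComponents.coe_eq_coe']
    exact pathComponent_subset_component _ h2.symm.joined_subtype
  have hsurj : Function.Surjective hχ.connectedComponentsLift := by
    intro f
    obtain ⟨B, hB, hBs⟩ := exists_blockSign_pos_iff (A := A)
      (T := Subtype.val '' {p | f p = false}) (Subtype.coe_image_subset _ _)
    refine ⟨((⟨B, hB⟩ : CentR A) : ConnectedComponents (CentR A)), ?_⟩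
    rw [hχ.connectedComponentsLift_apply_coe]
    funext p
    simp [χ, hBs p (σ p) p.2.1 (hσ p)]
  have := (jordanIndices_finite A).to_subtype
  rw [Nat.card_eq_of_bijective _ ⟨hinj, hsurj⟩, Nat.card_fun, Nat.card_eq_fintype_card (α := Bool),
    Fintype.card_bool, Nat.card_coe_set_eq]
  rfl
end

section
/- Let U be a unital nondiscrete subring of ℝ and let A be an n×n primitive matrix with entries in U₊ and with positive trace. Then A is strong shift equivalent over U₊ to a positive matrix of size at most 2n². -/
open Matrix

/-- A square real matrix is strongly connected if every nonempty proper set of indices is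
entered from outside along a positive entry. -/
def StronglyConnected {n : ℕ} (M : Matrix (Fin n) (Fin n) ℝ) : Prop :=
  ∀ T : Set (Fin n), T.Nonempty → T ≠ Set.univ → ∃ u ∉ T, ∃ w ∈ T, 0 < M u w

theorem StronglyConnected.mono {n : ℕ} {M N : Matrix (Fin n) (Fin n) ℝ}
    (hM : StronglyConnected M) (h : ∀ i j, 0 < M i j → 0 < N i j) : StronglyConnected N := by
  intro T h1 h2
  obtain ⟨u, hu, w, hw, h3⟩ := hM T h1 h2
  exact ⟨u, hu, w, hw, h u w h3⟩

theorem stronglyConnected_of_pow_pos {n k : ℕ} {A : Matrix (Fin n) (Fin n) ℝ}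
    (hA : ∀ i j, 0 ≤ A i j) (hk : ∀ i j, 0 < (A ^ k) i j) : StronglyConnected A := by
  intro T ⟨w, hw⟩ hT
  obtain ⟨u, hu⟩ := (Set.ne_univ_iff_exists_notMem T).1 hT
  by_contra! h
  have key : ∀ l : ℕ, ∀ x ∉ T, (A ^ l) x w = 0 := by
    intro l
    induction l with
    | zero =>
      intro x hx
      have : x ≠ w := fun e => hx (e ▸ hw)
      simp [this]
    | succ l ih =>
      intro x hx
      rw [pow_succ', Matrix.mul_apply]
      refine Finset.sum_eq_zero fun z _ => ?_
      by_cases hz : z ∈ T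
      · rw [le_antisymm (h x hx z hz) (hA x z), zero_mul]
      · rw [ih z hz, mul_zero]
  exact (hk u w).ne' (key k u hu)

theorem exists_pos_mem_lt {U : Subring ℝ} (hU : Dense (U : Set ℝ)) {ι : Type*} [Finite ι]
    (b : ι → ℝ) (hb : ∀ i, 0 < b i) : ∃ ε ∈ U, 0 < ε ∧ ∀ i, ε < b i := by
  obtain ⟨δ, hδ, h⟩ : ∃ δ : ℝ, 0 < δ ∧ ∀ i, δ ≤ b i := by
    rcases isEmpty_or_nonempty ι with h | h
    · exact ⟨1, one_pos, fun i => h.elim i⟩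
    · obtain ⟨i, hi⟩ := Finite.exists_min b
      exact ⟨b i, hb i, hi⟩
  obtain ⟨ε, hε, h1, h2⟩ := hU.exists_between hδ
  exact ⟨ε, hε, h1, fun i => h2.trans_le (h i)⟩

/-- Splitting off one new index whose incoming support is the set of two-step predecessors
of an index `y` carrying a loop, together with the new index itself. -/
theorem exists_esse_adjoin {U : Subring ℝ} (hU : Dense (U : Set ℝ)) {m : ℕ}
    {M : Matrix (Fin m) (Fin m) ℝ} (hM : entriesIn {x : ℝ | x ∈ U ∧ 0 ≤ x} M)
    (hc : StronglyConnected M) {y : Fin m} (hy : 0 < M y y) :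
    ∃ B : Matrix (Fin (m + 1)) (Fin (m + 1)) ℝ,
      ESSE {x : ℝ | x ∈ U ∧ 0 ≤ x} ⟨m, M⟩ ⟨m + 1, B⟩ ∧
      entriesIn {x : ℝ | x ∈ U ∧ 0 ≤ x} B ∧ StronglyConnected B ∧ 0 < B 0 0 ∧
      ∀ u w, 0 < M u w → 0 < M w y → 0 < B u.succ 0 := by
  classical
  obtain ⟨ε, hεU, hε, hεM⟩ := exists_pos_mem_lt hU
    (fun v : {v : Fin m // 0 < M v y} => M v y) (fun v => v.2)
  let V : Subsemiring ℝ := U.toSubsemiring ⊓ Subsemiring.nonneg ℝ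
  have hV : ∀ x, x ∈ V ↔ x ∈ U ∧ 0 ≤ x := fun x => Iff.rfl
  let r : Fin m → ℝ := fun i => if 0 < M i y then 1 else 0
  let s : Fin m → ℝ := fun j => if j = y then ε else 0
  let N : Matrix (Fin m) (Fin m) ℝ := fun i j => M i j - r i * s j
  have hr : ∀ i, r i ∈ V := by
    intro i
    by_cases h : 0 < M i y <;> simp [r, h, V.one_mem, V.zero_mem]
  have hs : ∀ j, s j ∈ V := by
    intro j
    by_cases h : j = y
    · simpa [s, h] using (hV ε).2 ⟨hεU, hε.le⟩
    · simp [s, h, V.zero_mem]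
  have hNM : ∀ i j, 0 < M i j → 0 < N i j := by
    intro i j h
    by_cases hj : j = y
    · subst hj
      simpa [N, r, s, h] using hεM ⟨i, h⟩
    · simpa [N, s, hj] using h
  have hN : ∀ i j, N i j ∈ V := by
    intro i j
    refine (hV _).2 ⟨U.sub_mem (hM i j).1 (U.mul_mem (hr i).1 (hs j).1), ?_⟩
    rcases (hM i j).2.lt_or_eq with h | h
    · exact (hNM i j h).le
    · by_cases hj : j = y
      · subst hj
        simp [N, r, ← h]
      · simp [N, s, hj, ← h]
  let R : Matrix (Fin m) (Fin (m + 1)) ℝ :=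
    fun i j => Fin.cases (r i) (fun k => (1 : Matrix (Fin m) (Fin m) ℝ) i k) j
  let S : Matrix (Fin (m + 1)) (Fin m) ℝ := fun i j => Fin.cases (s j) (fun k => N k j) i
  have hR : ∀ i j, R i j ∈ V := by
    intro i j
    refine Fin.cases (hr i) (fun k => ?_) j
    by_cases h : i = k <;> simp [R, Matrix.one_apply, h, V.one_mem, V.zero_mem]
  have hS : ∀ i j, S i j ∈ V := by
    intro i j
    exact Fin.cases (hs j) (fun k => hN k j) i
  have hSR : ∀ i j, (S * R) i j ∈ V := by
    intro i j
    rw [Matrix.mul_apply]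
    exact V.sum_mem fun k _ => V.mul_mem (hS i k) (hR k j)
  have hpos : ∀ i j k, 0 < S i k → 0 < R k j → 0 < (S * R) i j := by
    intro i j k h1 h2
    rw [Matrix.mul_apply]
    exact Finset.sum_pos' (fun l _ => mul_nonneg (hS i l).2 (hR l j).2)
      ⟨k, Finset.mem_univ k, mul_pos h1 h2⟩
  have hsy : 0 < S 0 y := by simpa [S, s] using hε
  have hRy : ∀ w, 0 < M w y → 0 < R w 0 := by
    intro w h
    simp [R, r, h]
  have hRI : ∀ j : Fin m, 0 < R j j.succ := by
    intro j
    simp [R]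
  have hpred : ∀ u w, 0 < M u w → 0 < M w y → 0 < (S * R) u.succ 0 :=
    fun u w h1 h2 => hpos _ _ w (hNM u w h1) (hRy w h2)
  refine ⟨S * R, ⟨R, S, hR, hS, ?_, rfl⟩, hSR, ?_, hpos _ _ y hsy (hRy y hy), hpred⟩
  · ext i j
    change M i j = (R * S) i j
    rw [Matrix.mul_apply, Fin.sum_univ_succ]
    simp [R, S, N, Matrix.one_apply]
  · intro T hT hT'
    by_cases h1 : (Fin.succ ⁻¹' T).Nonempty
    · by_cases h2 : Fin.succ ⁻¹' T = Set.univ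
      · have hsucc : ∀ j : Fin m, j.succ ∈ T := fun j => by
          have : j ∈ Fin.succ ⁻¹' T := h2 ▸ Set.mem_univ j
          exact this
        refine ⟨0, fun h0 => hT' ?_, y.succ, hsucc y, hpos _ _ y hsy (hRI y)⟩
        exact Set.eq_univ_of_forall fun j => Fin.cases h0 hsucc j
      · obtain ⟨u, hu, w, hw, h⟩ := hc _ h1 h2
        exact ⟨u.succ, hu, w.succ, hw, hpos _ _ w (hNM u w h) (hRI w)⟩
    · have hsucc : ∀ j : Fin m, j.succ ∉ T := fun j hj => h1 ⟨j, hj⟩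
      obtain ⟨x, hx⟩ := hT
      have h0 : (0 : Fin (m + 1)) ∈ T := by
        induction x using Fin.cases with
        | zero => exact hx
        | succ j => exact absurd hx (hsucc j)
      exact ⟨y.succ, hsucc y, 0, h0, hpred y y hy hy⟩

theorem exists_sse_pos_col {U : Subring ℝ} (hU : Dense (U : Set ℝ)) (c : ℕ) :
    ∀ {m : ℕ} {M : Matrix (Fin m) (Fin m) ℝ}, entriesIn {x : ℝ | x ∈ U ∧ 0 ≤ x} M →
      StronglyConnected M → ∀ y : Fin m, 0 < M y y →
      {u | ¬ 0 < M u y}.ncard ≤ c →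
      ∃ (m' : ℕ) (B : Matrix (Fin m') (Fin m') ℝ), m' ≤ m + c ∧
        SSE {x : ℝ | x ∈ U ∧ 0 ≤ x} ⟨m, M⟩ ⟨m', B⟩ ∧
        entriesIn {x : ℝ | x ∈ U ∧ 0 ≤ x} B ∧ StronglyConnected B ∧
        ∃ z, ∀ x, 0 < B x z := by
  induction c with
  | zero =>
    intro m M hM hc y hy h
    refine ⟨m, M, le_rfl, Relation.ReflTransGen.refl, hM, hc, y, fun x => ?_⟩
    by_contra hx
    rw [Nat.le_zero, Set.ncard_eq_zero] at h
    exact (Set.eq_empty_iff_forall_notMem.1 h x) hx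
  | succ c ih =>
    intro m M hM hc y hy h
    by_cases hfull : ∀ x, 0 < M x y
    · exact ⟨m, M, by omega, Relation.ReflTransGen.refl, hM, hc, y, hfull⟩
    · obtain ⟨B, hMB, hB, hcB, h0, hpred⟩ := exists_esse_adjoin hU hM hc hy
      obtain ⟨u, hu, w, hw, huw⟩ := hc {u | 0 < M u y} ⟨y, hy⟩
        (fun e => hfull fun x => by
          have : x ∈ {u | 0 < M u y} := e ▸ Set.mem_univ x
          exact this)
      have hsub : {v | ¬ 0 < B v 0} ⊆ Fin.succ '' ({v | ¬ 0 < M v y} \ {u}) := by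
        intro v hv
        induction v using Fin.cases with
        | zero => exact absurd h0 hv
        | succ j =>
          refine ⟨j, ⟨fun hj => hv (hpred j y hj hy), ?_⟩, rfl⟩
          rintro rfl
          exact hv (hpred j w huw hw)
      have hcard : {v | ¬ 0 < B v 0}.ncard ≤ c := by
        have h1 := Set.ncard_le_ncard hsub
        have h2 := Set.ncard_image_le (f := Fin.succ)
          (Set.toFinite ({v | ¬ 0 < M v y} \ {u}))
        have h3 := Set.ncard_sdiff_singleton_add_one
          (show u ∈ {v | ¬ 0 < M v y} from hu)
        omega
      obtain ⟨m', B', hm', hs, hrest⟩ := ih hB hcB 0 h0 hcard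
      exact ⟨m', B', by omega, Relation.ReflTransGen.head hMB hs, hrest⟩

/-- If column `u` is positive, a conjugation adds the support of row `u` to every row without
losing any positive entry. -/
theorem exists_esse_add_row {U : Subring ℝ} (hU : Dense (U : Set ℝ)) {m : ℕ}
    {M : Matrix (Fin m) (Fin m) ℝ} (hM : entriesIn {x : ℝ | x ∈ U ∧ 0 ≤ x} M)
    {u : Fin m} (hu : ∀ x, 0 < M x u) :
    ∃ B : Matrix (Fin m) (Fin m) ℝ,
      ESSE {x : ℝ | x ∈ U ∧ 0 ≤ x} ⟨m, M⟩ ⟨m, B⟩ ∧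
      entriesIn {x : ℝ | x ∈ U ∧ 0 ≤ x} B ∧ (∀ i j, 0 < M i j → 0 < B i j) ∧
      ∀ i j, 0 < M u j → 0 < B i j := by
  classical
  let r : Fin m → ℝ := fun i => if i = u then 0 else 1
  have hr : ∀ i, 0 ≤ r i ∧ r i ∈ U := by
    intro i
    by_cases h : i = u <;> simp [r, h, U.one_mem, U.zero_mem]
  have hq : ∀ i, 0 ≤ (M *ᵥ r) i ∧ (M *ᵥ r) i ∈ U := by
    intro i
    simp only [Matrix.mulVec, dotProduct]
    exact ⟨Finset.sum_nonneg fun k _ => mul_nonneg (hM i k).2 (hr k).1,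
      U.sum_mem fun k _ => U.mul_mem (hM i k).1 (hr k).2⟩
  obtain ⟨t, htU, ht, htM⟩ := exists_pos_mem_lt hU
    (fun x => M x u / ((M *ᵥ r) x + 1))
    (fun x => div_pos (hu x) (by linarith [(hq x).1]))
  have hlt : ∀ x, t * (M *ᵥ r) x < M x u := by
    intro x
    have h := (lt_div_iff₀ (by linarith [(hq x).1])).1 (htM x)
    linarith
  let E : Matrix (Fin m) (Fin m) ℝ := t • vecMulVec r (Pi.single u 1)
  have hE : ∀ i j, E i j = if j = u then t * r i else 0 := by
    intro i j
    by_cases h : j = u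
    · subst h
      simp [E, vecMulVec_apply]
    · simp [E, vecMulVec_apply, h]
  have hEE : E * E = 0 := by
    ext i j
    rw [Matrix.mul_apply]
    refine Finset.sum_eq_zero fun k _ => ?_
    rw [hE, hE]
    by_cases h : k = u <;> simp [h, r]
  have hME : ∀ i j, (M * E) i j = if j = u then t * (M *ᵥ r) i else 0 := by
    intro i j
    rw [Matrix.mul_apply]
    by_cases h : j = u
    · simp only [hE, h, if_true, Matrix.mulVec, dotProduct, Finset.mul_sum]
      exact Finset.sum_congr rfl fun k _ => by ring
    · simp [hE, h]
  let N := M - M * E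
  let F := 1 + E
  have hNM : ∀ i j, 0 < M i j → 0 < N i j := by
    intro i j h
    by_cases hj : j = u
    · subst hj
      simpa [N, hME] using hlt i
    · simpa [N, hME, hj] using h
  have hN : ∀ i j, N i j ∈ U ∧ 0 ≤ N i j := by
    intro i j
    by_cases hj : j = u
    · subst hj
      simpa [N, hME] using
        ⟨U.sub_mem (hM i j).1 (U.mul_mem htU (hq i).2), (hlt i).le⟩
    · simpa [N, hME, hj] using hM i j
  have hF : ∀ i j, F i j ∈ U ∧ 0 ≤ F i j := by
    intro i j
    have h1 : (1 : Matrix (Fin m) (Fin m) ℝ) i j ∈ U ∧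
        0 ≤ (1 : Matrix (Fin m) (Fin m) ℝ) i j := by
      by_cases h : i = j <;> simp [Matrix.one_apply, h, U.one_mem, U.zero_mem]
    have h2 : E i j ∈ U ∧ 0 ≤ E i j := by
      rw [hE]
      by_cases h : j = u
      · simpa [h] using ⟨U.mul_mem htU (hr i).2, mul_nonneg ht.le (hr i).1⟩
      · simp [h, U.zero_mem]
    exact ⟨U.add_mem h1.1 h2.1, add_nonneg h1.2 h2.2⟩
  have hpos : ∀ i j k, 0 < F i k → 0 < N k j → 0 < (F * N) i j := by
    intro i j k h1 h2
    rw [Matrix.mul_apply]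
    exact Finset.sum_pos' (fun l _ => mul_nonneg (hF i l).2 (hN l j).2)
      ⟨k, Finset.mem_univ k, mul_pos h1 h2⟩
  have hFd : ∀ i, 0 < F i i := by
    intro i
    by_cases h : i = u
    · simp [F, hE, h, r]
    · simp [F, hE, h]
  have hFu : ∀ i, 0 < F i u := by
    intro i
    by_cases h : i = u
    · exact h ▸ hFd i
    · simpa [F, hE, Matrix.one_apply, h, r] using ht
  refine ⟨F * N, ⟨N, F, hN, hF, ?_, rfl⟩, fun i j => ?_,
    fun i j h => hpos i j i (hFd i) (hNM i j h),
    fun i j h => hpos i j u (hFu i) (hNM u j h)⟩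
  · change M = (M - M * E) * (1 + E)
    rw [mul_add, mul_one, sub_mul, Matrix.mul_assoc, hEE]
    simp
  · rw [Matrix.mul_apply]
    exact ⟨U.sum_mem fun k _ => U.mul_mem (hF i k).1 (hN k j).1,
      Finset.sum_nonneg fun k _ => mul_nonneg (hF i k).2 (hN k j).2⟩

theorem exists_sse_posEntries {U : Subring ℝ} (hU : Dense (U : Set ℝ)) {m : ℕ} (c : ℕ) :
    ∀ {M : Matrix (Fin m) (Fin m) ℝ}, entriesIn {x : ℝ | x ∈ U ∧ 0 ≤ x} M →
      StronglyConnected M → (∃ z, ∀ x, 0 < M x z) →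
      {j | ¬ ∀ x, 0 < M x j}.ncard ≤ c →
      ∃ B : Matrix (Fin m) (Fin m) ℝ, SSE {x : ℝ | x ∈ U ∧ 0 ≤ x} ⟨m, M⟩ ⟨m, B⟩ ∧
        entriesIn {x : ℝ | x ∈ U ∧ 0 ≤ x} B ∧ PosEntries B := by
  induction c with
  | zero =>
    intro M hM _ _ h
    refine ⟨M, Relation.ReflTransGen.refl, hM, fun i j => ?_⟩
    rw [Nat.le_zero, Set.ncard_eq_zero] at h
    exact not_not.1 (Set.eq_empty_iff_forall_notMem.1 h j) i
  | succ c ih =>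
    intro M hM hc ⟨z, hz⟩ h
    by_cases hfull : ∀ j x, 0 < M x j
    · exact ⟨M, Relation.ReflTransGen.refl, hM, fun i j => hfull j i⟩
    · obtain ⟨u, hu, w, hw, huw⟩ := hc {j | ¬ ∀ x, 0 < M x j}
        (by simpa [Set.Nonempty] using hfull)
        (fun e => (e ▸ Set.mem_univ z : z ∈ {j | ¬ ∀ x, 0 < M x j}) hz)
      obtain ⟨B, hMB, hB, hmono, hrow⟩ := exists_esse_add_row hU hM (not_not.1 hu)
      have hsub : {j | ¬ ∀ x, 0 < B x j} ⊆ {j | ¬ ∀ x, 0 < M x j} \ {w} := by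
        intro j hj
        refine ⟨fun h' => hj fun x => hmono x j (h' x), ?_⟩
        rintro rfl
        exact hj fun x => hrow x j huw
      have hcard : {j | ¬ ∀ x, 0 < B x j}.ncard ≤ c := by
        have h1 := Set.ncard_le_ncard hsub
        have h3 := Set.ncard_sdiff_singleton_add_one hw
        omega
      obtain ⟨B', hs, hrest⟩ := ih hB (hc.mono hmono) ⟨z, fun x => hmono x z (hz x)⟩ hcard
      exact ⟨B', Relation.ReflTransGen.head hMB hs, hrest⟩

/-- A primitive matrix over `U₊` with positive trace is strong shift equivalent over
`U₊` to a positive matrix of size at most `2n²`. -/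
theorem primitive_to_positive (U : Subring ℝ) (hU : Dense (U : Set ℝ))
    {n : ℕ} (A : Matrix (Fin n) (Fin n) ℝ)
    (hAU : entriesIn {x : ℝ | x ∈ U ∧ 0 ≤ x} A)
    (hprim : ∃ k : ℕ, 0 < k ∧ ∀ i j, 0 < (A ^ k) i j)
    (htr : 0 < A.trace) :
    ∃ (m : ℕ) (B : Matrix (Fin m) (Fin m) ℝ),
      m ≤ 2 * n ^ 2 ∧ PosEntries B ∧ entriesIn (U : Set ℝ) B ∧
      SSE {x : ℝ | x ∈ U ∧ 0 ≤ x} ⟨n, A⟩ ⟨m, B⟩ := by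
  obtain ⟨k, -, hk⟩ := hprim
  obtain ⟨y, -, hy⟩ := Finset.exists_lt_of_sum_lt (s := Finset.univ) (f := fun _ => (0 : ℝ))
    (g := fun i => A i i) (by simpa [Matrix.trace] using htr)
  obtain ⟨m, M, hm, hAM, hM, hMc, hMz⟩ := exists_sse_pos_col hU n hAU
    (stronglyConnected_of_pow_pos (fun i j => (hAU i j).2) hk) y hy
    (by simpa using Set.ncard_le_card {u | ¬ 0 < A u y})
  obtain ⟨B, hMB, hB, hBpos⟩ := exists_sse_posEntries hU _ hM hMc hMz le_rfl
  exact ⟨m, B, by nlinarith [y.pos], hBpos, fun i j => (hB i j).1, hAM.trans hMB⟩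
end

section
/- Given real numbers 0 < ε < κ and n ∈ ℕ, there exists δ > 0 such that for every n×n real matrix M with all entries in the interval [ε, κ] and every U ∈ SL(n,ℝ) with ‖U − I‖ < δ (max-norm), the matrix U⁻¹MU is positive and is strong shift equivalent over ℝ₊ to M. -/
open Matrix

open Filter Topology

lemma continuousAt_nonsing_inv {n : ℕ} {A : Matrix (Fin n) (Fin n) ℝ} (hA : A.det ≠ 0) :
    ContinuousAt (fun B : Matrix (Fin n) (Fin n) ℝ => B⁻¹) A := by
  simp only [Matrix.inv_def, Ring.inverse_eq_inv']
  exact (continuous_id.matrix_det.continuousAt.inv₀ hA).smul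
    continuous_id.matrix_adjugate.continuousAt

lemma isOpen_setOf_posEntries {m n : ℕ} :
    IsOpen {A : Matrix (Fin m) (Fin n) ℝ | PosEntries A} := by
  simp only [PosEntries, Set.ofPred_forall]
  exact isOpen_iInter_of_finite fun i => isOpen_iInter_of_finite fun j =>
    isOpen_lt continuous_const (continuous_id.matrix_elem i j)

lemma isCompact_setOf_entries_mem_Icc (n : ℕ) (a b : ℝ) :
    IsCompact {M : Matrix (Fin n) (Fin n) ℝ | ∀ i j, a ≤ M i j ∧ M i j ≤ b} := by
  have h : IsCompact (Set.univ.pi fun _ : Fin n => Set.univ.pi fun _ : Fin n => Set.Icc a b) :=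
    isCompact_univ_pi fun _ => isCompact_univ_pi fun _ => isCompact_Icc
  simpa only [Set.pi, Set.mem_univ, Set.mem_Icc, forall_const] using! h

/-- Two-sided multiplication by matrices close to the identity preserves positivity, uniformly
over a compact set of positive matrices. -/
lemma eventually_posEntries_mul_mul {n : ℕ} {K : Set (Matrix (Fin n) (Fin n) ℝ)}
    (hK : IsCompact K) (hpos : ∀ M ∈ K, PosEntries M) :
    ∀ᶠ p in 𝓝 ((1, 1) : Matrix (Fin n) (Fin n) ℝ × Matrix (Fin n) (Fin n) ℝ),
      ∀ M ∈ K, PosEntries (p.1 * M * p.2) := by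
  refine hK.eventually_forall_of_forall_eventually fun M hM => ?_
  have hc : Continuous fun q : (Matrix (Fin n) (Fin n) ℝ × Matrix (Fin n) (Fin n) ℝ) ×
      Matrix (Fin n) (Fin n) ℝ => q.1.1 * q.2 * q.1.2 := by fun_prop
  refine hc.continuousAt.eventually (isOpen_setOf_posEntries.mem_nhds ?_)
  simpa using hpos M hM

lemma exists_abs_sub_lt_of_eventually_nhds {n : ℕ} {A : Matrix (Fin n) (Fin n) ℝ}
    {p : Matrix (Fin n) (Fin n) ℝ → Prop} (h : ∀ᶠ U in 𝓝 A, p U) :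
    ∃ δ > 0, ∀ U : Matrix (Fin n) (Fin n) ℝ, (∀ i j, |(U - A) i j| < δ) → p U := by
  obtain ⟨δ, hδ, H⟩ := Metric.eventually_nhds_iff.1
    (show ∀ᶠ U : Fin n → Fin n → ℝ in 𝓝 (fun i j => A i j), p U from h)
  refine ⟨δ, hδ, fun U hU => H ?_⟩
  refine (dist_pi_lt_iff hδ).2 fun i => (dist_pi_lt_iff hδ).2 fun j => ?_
  rw [Real.dist_eq]
  exact hU i j

/-- If `U = A * P⁻¹` with `A` and `P` nonnegative, then conjugation by `U` factors through two
elementary equivalences as soon as `A⁻¹ * M` and `A⁻¹ * M * U` are nonnegative. -/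
lemma sse_conj_of_nonneg {n : ℕ} {M U P : Matrix (Fin n) (Fin n) ℝ}
    (hU : U.det ≠ 0) (hP : P.det ≠ 0) (hP₀ : ∀ i j, 0 ≤ P i j) (hA₀ : ∀ i j, 0 ≤ (U * P) i j)
    (hM : ∀ i j, 0 ≤ ((U * P)⁻¹ * M) i j) (hMU : ∀ i j, 0 ≤ ((U * P)⁻¹ * M * U) i j) :
    SSE {x : ℝ | 0 ≤ x} ⟨n, M⟩ ⟨n, U⁻¹ * M * U⟩ := by
  have hA : IsUnit (U * P).det := by
    rw [Matrix.det_mul]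
    exact (mul_ne_zero hU hP).isUnit
  have hPA : P * (U * P)⁻¹ = U⁻¹ := by
    rw [Matrix.mul_inv_rev, Matrix.mul_nonsing_inv_cancel_left _ _ hP.isUnit]
  refine (Relation.ReflTransGen.single (b := ⟨n, (U * P)⁻¹ * M * (U * P)⟩) ?_).tail ?_
  · refine ⟨U * P, (U * P)⁻¹ * M, hA₀, hM, ?_, rfl⟩
    exact (Matrix.mul_nonsing_inv_cancel_left _ M hA).symm
  · refine ⟨(U * P)⁻¹ * M * U, P, hMU, hP₀, ?_, ?_⟩
    · simp only [Matrix.mul_assoc]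
    · simp only [← hPA, Matrix.mul_assoc]

/-- For `0 < ε < κ` there is `δ > 0` such that for every `n × n` matrix `M` with
entries in `[ε, κ]` and every `U ∈ SL(n,ℝ)` with `‖U - I‖ < δ` in the max norm,
`U⁻¹MU` is positive and strong shift equivalent over `ℝ₊` to `M`. -/
theorem positive_close (n : ℕ) (ε κ : ℝ) (hε : 0 < ε) (hεκ : ε < κ) :
    ∃ δ > 0, ∀ M : Matrix (Fin n) (Fin n) ℝ,
      (∀ i j, ε ≤ M i j ∧ M i j ≤ κ) →
      ∀ U : Matrix (Fin n) (Fin n) ℝ, U.det = 1 →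
        (∀ i j, |(U - 1) i j| < δ) →
        PosEntries (U⁻¹ * M * U) ∧
        SSE {x : ℝ | 0 ≤ x} ⟨n, M⟩ ⟨n, U⁻¹ * M * U⟩ := by
  set K := {M : Matrix (Fin n) (Fin n) ℝ | ∀ i j, ε ≤ M i j ∧ M i j ≤ κ}
  have hpos := eventually_posEntries_mul_mul (isCompact_setOf_entries_mem_Icc n ε κ)
    fun M hM i j => hε.trans_le (hM i j).1
  let P : ℝ → Matrix (Fin n) (Fin n) ℝ := fun c => 1 + c • Matrix.of fun _ _ => 1
  have hPc : Continuous P := by fun_prop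
  have hP0 : P 0 = 1 := by simp [P]
  have hA : Continuous fun q : ℝ × Matrix (Fin n) (Fin n) ℝ => q.2 * P q.1 := by fun_prop
  have hinv : Tendsto (fun B : Matrix (Fin n) (Fin n) ℝ => B⁻¹) (𝓝 1) (𝓝 1) := by
    simpa [ContinuousAt] using continuousAt_nonsing_inv (n := n) (A := 1) (by simp)
  have hAinv : Tendsto (fun q : ℝ × Matrix (Fin n) (Fin n) ℝ => (q.2 * P q.1)⁻¹)
      (𝓝 (0, 1)) (𝓝 1) := by
    have h₁ : Tendsto (fun q : ℝ × Matrix (Fin n) (Fin n) ℝ => q.2 * P q.1)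
        (𝓝 (0, 1)) (𝓝 1) := by simpa [hP0] using hA.tendsto (0, 1)
    exact hinv.comp h₁
  have hsnd : Tendsto (fun q : ℝ × Matrix (Fin n) (Fin n) ℝ => q.2) (𝓝 (0, 1)) (𝓝 1) :=
    continuous_snd.tendsto (0, 1)
  have hM := (hAinv.prodMk_nhds (tendsto_const_nhds (x := 1))).eventually hpos
  have hMU := (hAinv.prodMk_nhds hsnd).eventually hpos
  have hdet : ∀ᶠ c in 𝓝 (0 : ℝ), (P c).det ≠ 0 :=
    hPc.matrix_det.continuousAt.eventually_ne (by simp [hP0])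
  have hnhds := hM.and hMU
  rw [nhds_prod_eq] at hnhds
  obtain ⟨c, ⟨hc, hcdet⟩, hc₀ : 0 < c⟩ :=
    (((hnhds.curry.and hdet).filter_mono nhdsWithin_le_nhds).and
      (self_mem_nhdsWithin (s := Set.Ioi (0 : ℝ)))).exists
  have hPpos : PosEntries (P c) := by
    intro i j
    have : (0 : ℝ) ≤ (1 : Matrix (Fin n) (Fin n) ℝ) i j := by
      rw [Matrix.one_apply]
      split_ifs <;> norm_num
    simpa [P] using add_pos_of_nonneg_of_pos this hc₀
  have hApos : ∀ᶠ U in 𝓝 (1 : Matrix (Fin n) (Fin n) ℝ), PosEntries (U * P c) := by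
    have h : Continuous fun U : Matrix (Fin n) (Fin n) ℝ => U * P c := by fun_prop
    refine h.continuousAt.eventually (isOpen_setOf_posEntries.mem_nhds ?_)
    simpa using hPpos
  have hconj : ∀ᶠ U in 𝓝 (1 : Matrix (Fin n) (Fin n) ℝ),
      ∀ M ∈ K, PosEntries (U⁻¹ * M * U) :=
    (hinv.prodMk_nhds tendsto_id).eventually hpos
  obtain ⟨δ, hδ, H⟩ := exists_abs_sub_lt_of_eventually_nhds (hc.and (hApos.and hconj))
  refine ⟨δ, hδ, fun M hMK U hU hUδ => ?_⟩
  obtain ⟨⟨h₁, h₂⟩, h₃, h₄⟩ := H U hUδ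
  refine ⟨h₄ M hMK, sse_conj_of_nonneg (P := P c) (by simp [hU]) hcdet
    (fun i j => (hPpos i j).le) (fun i j => (h₃ i j).le) (fun i j => ?_)
    (fun i j => (h₂ M hMK i j).le)⟩
  simpa using (h₁ M hMK i j).le
end

section
/- Let U be a nondiscrete unital subring of ℝ, let B be an n×n positive matrix with entries in U, and let d > 0. Then there exists ε > 0 such that for every n×n matrix V which is invertible over U (V and V⁻¹ have entries in U) and satisfies ‖V − dI‖ < ε (max-norm), the matrix V⁻¹BV is positive and is strong shift equivalent over U₊ to B. -/
open Matrix

open Topology Filter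

theorem ESSE.symm {S : Set ℝ} {p q : (n : ℕ) × Matrix (Fin n) (Fin n) ℝ} (h : ESSE S p q) :
    ESSE S q p := by
  obtain ⟨R, T, hR, hT, hp, hq⟩ := h
  exact ⟨T, R, hT, hR, hq, hp⟩

theorem entriesIn.mul {U : Subring ℝ} {l m n : ℕ} {A : Matrix (Fin l) (Fin m) ℝ}
    {B : Matrix (Fin m) (Fin n) ℝ} (hA : entriesIn (U : Set ℝ) A)
    (hB : entriesIn (U : Set ℝ) B) : entriesIn (U : Set ℝ) (A * B) := by
  intro i j
  rw [Matrix.mul_apply]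
  exact U.sum_mem fun k _ => U.mul_mem (hA i k) (hB k j)

theorem entriesIn.adjugate {U : Subring ℝ} {n : ℕ} {A : Matrix (Fin n) (Fin n) ℝ}
    (hA : entriesIn (U : Set ℝ) A) : entriesIn (U : Set ℝ) A.adjugate := by
  let M : Matrix (Fin n) (Fin n) U := Matrix.of fun i j => ⟨A i j, hA i j⟩
  have hM : U.subtype.mapMatrix M = A := rfl
  intro i j
  rw [← hM, ← RingHom.map_adjugate]
  exact (M.adjugate i j).2

/-- Conjugation by a positive invertible matrix `P` is an elementary strong shift equivalence
as soon as `P⁻¹A` is positive. -/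
theorem ESSE.of_conj {U : Subring ℝ} {n : ℕ} {A P Q : Matrix (Fin n) (Fin n) ℝ}
    (hA : entriesIn (U : Set ℝ) A) (hP : entriesIn (U : Set ℝ) P)
    (hQ : entriesIn (U : Set ℝ) Q) (hPQ : P * Q = 1) (hPpos : PosEntries P)
    (hQA : PosEntries (Q * A)) :
    ESSE {x : ℝ | x ∈ U ∧ 0 ≤ x} ⟨n, A⟩ ⟨n, Q * A * P⟩ := by
  refine ⟨P, Q * A, fun i j => ⟨hP i j, (hPpos i j).le⟩,
    fun i j => ⟨hQ.mul hA i j, (hQA i j).le⟩, ?_, rfl⟩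
  rw [← Matrix.mul_assoc, hPQ, Matrix.one_mul]

theorem PosEntries.eventually {X : Type*} [TopologicalSpace X] {m n : ℕ}
    {f : X → Matrix (Fin m) (Fin n) ℝ} {x : X} (hf : ContinuousAt f x)
    (hx : PosEntries (f x)) : ∀ᶠ y in 𝓝 x, PosEntries (f y) := by
  refine eventually_all.2 fun i => eventually_all.2 fun j => ?_
  have h : ContinuousAt (fun y => f y i j) x :=
    (continuous_id.matrix_elem i j).continuousAt.comp hf
  exact h.eventually (lt_mem_nhds (hx i j))

theorem exists_entrywise_ball_of_eventually {m n : ℕ} {A : Matrix (Fin m) (Fin n) ℝ}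
    {p : Matrix (Fin m) (Fin n) ℝ → Prop} (h : ∀ᶠ V in 𝓝 A, p V) :
    ∃ ε > 0, ∀ V, (∀ i j, |(V - A) i j| < ε) → p V := by
  obtain ⟨ε, hε, H⟩ := (Metric.eventually_nhds_iff (α := Fin m → Fin n → ℝ)).1 h
  refine ⟨ε, hε, fun V hV => H ?_⟩
  exact (dist_pi_lt_iff hε).2 fun i => (dist_pi_lt_iff hε).2 fun j => hV i j

/-- The unipotent upper triangular matrix with all entries above the diagonal equal to `t`. -/
def upperUnipotent (n : ℕ) (t : ℝ) : Matrix (Fin n) (Fin n) ℝ :=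
  Matrix.of fun i j => if i = j then 1 else if i < j then t else 0

theorem det_upperUnipotent (n : ℕ) (t : ℝ) : (upperUnipotent n t).det = 1 := by
  rw [Matrix.det_of_isUpperTriangular]
  · simp [upperUnipotent]
  · intro i j hij
    have hji : j < i := hij
    simp [upperUnipotent, hji.ne', hji.not_gt]

theorem upperUnipotent_zero (n : ℕ) : upperUnipotent n 0 = 1 := by
  ext i j
  simp [upperUnipotent, Matrix.one_apply]

theorem continuous_upperUnipotent (n : ℕ) : Continuous (upperUnipotent n) := by
  refine continuous_matrix fun i j => ?_
  simp only [upperUnipotent, Matrix.of_apply]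
  split_ifs <;> fun_prop

theorem entriesIn_upperUnipotent {U : Subring ℝ} (n : ℕ) {t : ℝ} (ht : t ∈ U) :
    entriesIn (U : Set ℝ) (upperUnipotent n t) := by
  intro i j
  simp only [upperUnipotent, Matrix.of_apply]
  split_ifs
  exacts [U.one_mem, ht, U.zero_mem]

theorem posEntries_upperUnipotent_mul_transpose (n : ℕ) {t : ℝ} (ht : 0 < t) :
    PosEntries (upperUnipotent n t * (upperUnipotent n t)ᵀ) := by
  intro i j
  rw [Matrix.mul_apply]
  have h0 : ∀ a b, 0 ≤ upperUnipotent n t a b := by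
    intro a b
    simp only [upperUnipotent, Matrix.of_apply]
    split_ifs <;> positivity
  have h1 : ∀ a b, a ≤ b → 0 < upperUnipotent n t a b := by
    intro a b hab
    simp only [upperUnipotent, Matrix.of_apply]
    split_ifs with h h'
    exacts [one_pos, ht, absurd (lt_of_le_of_ne hab h) h']
  exact Finset.sum_pos' (fun k _ => mul_nonneg (h0 _ _) (h0 _ _))
    ⟨max i j, Finset.mem_univ _,
      mul_pos (h1 _ _ (le_max_left i j)) (h1 _ _ (le_max_right i j))⟩

/-- Over a dense subring there are positive invertible matrices `W` so close to the identity
that `W⁻¹B` is still positive. -/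
theorem exists_posEntries_invertible {U : Subring ℝ} (hU : Dense (U : Set ℝ)) {n : ℕ}
    {B : Matrix (Fin n) (Fin n) ℝ} (hB : PosEntries B) :
    ∃ W Winv : Matrix (Fin n) (Fin n) ℝ, entriesIn (U : Set ℝ) W ∧
      entriesIn (U : Set ℝ) Winv ∧ W * Winv = 1 ∧ PosEntries W ∧ PosEntries (Winv * B) := by
  let W : ℝ → Matrix (Fin n) (Fin n) ℝ := fun t => upperUnipotent n t * (upperUnipotent n t)ᵀ
  have hW : Continuous W :=
    (continuous_upperUnipotent n).matrix_mul (continuous_upperUnipotent n).matrix_transpose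
  have hev : ∀ᶠ t in 𝓝 (0 : ℝ), PosEntries ((W t).adjugate * B) := by
    refine PosEntries.eventually (hW.matrix_adjugate.matrix_mul continuous_const).continuousAt ?_
    simpa [W, upperUnipotent_zero] using hB
  obtain ⟨r, hr, H⟩ := Metric.eventually_nhds_iff.1 hev
  obtain ⟨t, htU, ht0, htr⟩ := hU.exists_between hr
  have hL := entriesIn_upperUnipotent n htU
  have hWU : entriesIn (U : Set ℝ) (W t) := hL.mul fun i j => hL j i
  refine ⟨W t, (W t).adjugate, hWU, hWU.adjugate, ?_,
    posEntries_upperUnipotent_mul_transpose n ht0, H ?_⟩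
  · rw [Matrix.mul_adjugate]
    simp [W, det_upperUnipotent]
  · rwa [Real.dist_eq, sub_zero, abs_of_pos ht0]

/-- For `B` a positive matrix over a nondiscrete unital subring `U` of `ℝ` and `d > 0`,
there is `ε > 0` such that for every matrix `V` invertible over `U` with
`‖V - dI‖ < ε` in the max norm, `V⁻¹BV` is positive and strong shift equivalent over
`U₊` to `B`. -/
theorem diagonal_lemma (U : Subring ℝ) (hU : Dense (U : Set ℝ))
    {n : ℕ} (B : Matrix (Fin n) (Fin n) ℝ)
    (hBU : entriesIn (U : Set ℝ) B) (hBpos : PosEntries B)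
    (d : ℝ) (hd : 0 < d) :
    ∃ ε > 0, ∀ V Vinv : Matrix (Fin n) (Fin n) ℝ,
      entriesIn (U : Set ℝ) V → entriesIn (U : Set ℝ) Vinv →
      V * Vinv = 1 → Vinv * V = 1 →
      (∀ i j, |(V - d • (1 : Matrix (Fin n) (Fin n) ℝ)) i j| < ε) →
      PosEntries (Vinv * B * V) ∧
      SSE {x : ℝ | x ∈ U ∧ 0 ≤ x} ⟨n, B⟩ ⟨n, Vinv * B * V⟩ := by
  obtain ⟨W, Winv, hWU, hWinvU, hWW, hWpos, hWB⟩ := exists_posEntries_invertible hU hBpos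
  set D : Matrix (Fin n) (Fin n) ℝ := d • 1 with hD
  have hDdet : D.det ≠ 0 := by simp [hD, hd.ne']
  have hDinv : D⁻¹ = d⁻¹ • 1 := Matrix.inv_eq_right_inv (by simp [hD, hd.ne'])
  have hDconj : D⁻¹ * B * D = B := by
    rw [hDinv]
    simp [hD, hd.ne', smul_smul]
  have hinv := continuousAt_matrix_inv D (by
    rw [Ring.inverse_eq_inv']
    exact continuousAt_inv₀ hDdet)
  have hmul : ∀ {f g : Matrix (Fin n) (Fin n) ℝ → Matrix (Fin n) (Fin n) ℝ},
      ContinuousAt f D → ContinuousAt g D → ContinuousAt (fun V => f V * g V) D :=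
    fun hf hg => ContinuousAt.mul hf hg
  have hsmul : ∀ {c : ℝ} {M : Matrix (Fin n) (Fin n) ℝ}, 0 < c → PosEntries M →
      PosEntries (c • M) := fun hc hM i j => mul_pos hc (hM i j)
  have hVB := hmul hinv (continuousAt_const (y := B))
  have hconj := hmul hVB continuousAt_id
  have e₁ : ∀ᶠ V in 𝓝 D, PosEntries (V⁻¹ * B * V) := by
    refine PosEntries.eventually hconj ?_
    simpa [hDconj] using hBpos
  have e₂ : ∀ᶠ V in 𝓝 D, PosEntries (V * W) := by
    refine PosEntries.eventually (hmul continuousAt_id continuousAt_const) ?_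
    simpa [hD] using hsmul hd hWpos
  have e₃ : ∀ᶠ V in 𝓝 D, PosEntries (Winv * (V⁻¹ * B)) := by
    refine PosEntries.eventually (hmul continuousAt_const hVB) ?_
    simpa [hDinv] using hsmul (inv_pos.2 hd) hWB
  have e₄ : ∀ᶠ V in 𝓝 D, PosEntries (Winv * (V⁻¹ * B * V)) := by
    refine PosEntries.eventually (hmul continuousAt_const hconj) ?_
    simpa [hDconj] using hWB
  obtain ⟨ε, hε, H⟩ :=
    exists_entrywise_ball_of_eventually (e₁.and (e₂.and (e₃.and e₄)))
  refine ⟨ε, hε, fun V Vinv hV hVinv hVV _ hVε => ?_⟩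
  obtain ⟨h₁, h₂, h₃, h₄⟩ := H V hVε
  rw [Matrix.inv_eq_right_inv hVV] at h₁ h₃ h₄
  have hPQ : V * W * (Winv * Vinv) = 1 := by
    rw [Matrix.mul_assoc, ← Matrix.mul_assoc W, hWW, Matrix.one_mul, hVV]
  have s₁ := ESSE.of_conj hBU (hV.mul hWU) (hWinvU.mul hVinv) hPQ h₂
    (by rwa [Matrix.mul_assoc])
  have s₂ := ESSE.of_conj ((hVinv.mul hBU).mul hV) hWU hWinvU hWW hWpos h₄
  have heq : Winv * Vinv * B * (V * W) = Winv * (Vinv * B * V) * W := by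
    simp only [Matrix.mul_assoc]
  rw [heq] at s₁
  exact ⟨h₁, (Relation.ReflTransGen.single s₁).tail s₂.symm⟩
end
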